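/- arXiv:1909.11441 — 4 statements merged into one kernel-verified Lean document; each statement's English description precedes it below -/
import Mathlib

section
/- Let N ≥ 2 and 1 < α < N. For every L¹ function g : ℝ^N → [0,1], setting r = (‖g‖_{L¹}/ω_N)^{1/N}, one has 𝔉(g) ≤ 𝔉(B(r)), and the inequality is strict unless g equals (almost everywhere) the characteristic function of a ball of radius r. -/
open MeasureTheory Metric

noncomputable def funcEnergy (N : ℕ) (α : ℝ) (f : EuclideanSpace ℝ (Fin N) → ℝ) : ℝ :=
  ∫ x, ∫ y, f x * f y * ‖y - x‖ ^ (α - (N : ℝ))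

noncomputable def omegaN (N : ℕ) : ℝ :=
  (volume (ball (0 : EuclideanSpace ℝ (Fin N)) 1)).toReal

namespace RieszEnergy

open Filter Set
open scoped Topology RealInnerProductSpace

section Basic

variable {E : Type*} [NormedAddCommGroup E] [InnerProductSpace ℝ E] [FiniteDimensional ℝ E]
  [MeasurableSpace E] [BorelSpace E]

/-- An integrable function with values in `[0, 1]`. -/
structure IsDensity (f : E → ℝ) : Prop where
  integrable : Integrable f
  nonneg : ∀ x, 0 ≤ f x
  le_one : ∀ x, f x ≤ 1

variable (E) in
/-- The profile of a nonnegative, radially nonincreasing and locally integrable kernel on `E`. -/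
structure IsKernel (k : ℝ → ℝ) : Prop where
  measurable : Measurable k
  nonneg : ∀ t, 0 ≤ k t
  antitoneOn : AntitoneOn k (Ioi 0)
  integrableOn : IntegrableOn (fun z : E => k ‖z‖) (ball 0 1)

/-- The potential of the density `f` for the kernel `k`. -/
noncomputable def pot (k : ℝ → ℝ) (f : E → ℝ) (x : E) : ℝ := ∫ y, f y * k ‖x - y‖

/-- The mutual energy of `f` and `h` for the kernel `k`. -/
noncomputable def energy (k : ℝ → ℝ) (f h : E → ℝ) : ℝ :=
  ∫ p : E × E, f p.1 * h p.2 * k ‖p.1 - p.2‖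

/-- The part of the kernel supported in the unit ball. -/
noncomputable def nearKernel (k : ℝ → ℝ) : E → ℝ := (ball 0 1).indicator fun z => k ‖z‖

variable {k : ℝ → ℝ} {f h : E → ℝ}

lemma IsKernel.integrable_nearKernel (hk : IsKernel E k) :
    Integrable (nearKernel k : E → ℝ) :=
  (integrable_indicator_iff measurableSet_ball).2 hk.integrableOn

lemma IsKernel.le_nearKernel_add (hk : IsKernel E k) (z : E) : k ‖z‖ ≤ nearKernel k z + k 1 := by
  unfold nearKernel
  by_cases hz : z ∈ ball (0 : E) 1
  · rw [indicator_of_mem hz]; linarith [hk.nonneg 1]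
  · rw [indicator_of_notMem hz, zero_add]
    have : 1 ≤ ‖z‖ := by simpa using hz
    exact hk.antitoneOn (mem_Ioi.2 one_pos) (mem_Ioi.2 (by linarith)) this

lemma IsKernel.nearKernel_nonneg (hk : IsKernel E k) (z : E) : 0 ≤ nearKernel k z :=
  indicator_nonneg (fun _ _ => hk.nonneg _) _

lemma IsDensity.integrable_mul_kernel (hf : IsDensity f) (hk : IsKernel E k) (x : E) :
    Integrable fun y => f y * k ‖x - y‖ := by
  refine Integrable.mono' ((hk.integrable_nearKernel.comp_sub_left x).add
    (hf.integrable.mul_const (k 1))) (hf.integrable.aestronglyMeasurable.mul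
    (hk.measurable.comp (by fun_prop)).aestronglyMeasurable) (ae_of_all _ fun y => ?_)
  rw [Real.norm_of_nonneg (mul_nonneg (hf.nonneg _) (hk.nonneg _))]
  have h1 := hk.le_nearKernel_add (x - y)
  have h2 := hk.nearKernel_nonneg (x - y)
  simp only [Pi.add_apply]
  nlinarith [hf.nonneg y, hf.le_one y, hk.nonneg 1]

lemma IsDensity.integrable_energy (hf : IsDensity f) (hh : IsDensity h) (hk : IsKernel E k) :
    Integrable fun p : E × E => f p.1 * h p.2 * k ‖p.1 - p.2‖ := by
  have h0 : Integrable (fun p : E × E => h p.2 * nearKernel k (p.1 - p.2)) :=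
    hh.integrable.convolution_integrand (ContinuousLinearMap.mul ℝ ℝ) hk.integrable_nearKernel
  refine Integrable.mono' (h0.add
    ((hf.integrable.mul_prod hh.integrable).mul_const (k 1)))
    ((hf.integrable.aestronglyMeasurable.comp_fst.mul
      hh.integrable.aestronglyMeasurable.comp_snd).mul
    (hk.measurable.comp (by fun_prop)).aestronglyMeasurable) (ae_of_all _ fun p => ?_)
  have hm : 0 ≤ f p.1 * h p.2 := mul_nonneg (hf.nonneg _) (hh.nonneg _)
  rw [Real.norm_of_nonneg (mul_nonneg hm (hk.nonneg _))]
  have h1 := hk.le_nearKernel_add (p.1 - p.2)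
  have h2 := hk.nearKernel_nonneg (p.1 - p.2)
  simp only [Pi.add_apply]
  nlinarith [hf.nonneg p.1, hf.le_one p.1, hk.nonneg 1, mul_nonneg (hh.nonneg p.2) h2,
    mul_le_mul_of_nonneg_left h1 hm, mul_nonneg (sub_nonneg.2 (hf.le_one p.1))
      (mul_nonneg (hh.nonneg p.2) h2)]

lemma energy_eq_integral_pot (hf : IsDensity f) (hh : IsDensity h) (hk : IsKernel E k) :
    energy k f h = ∫ x, f x * pot k h x := by
  unfold energy pot
  rw [Measure.volume_eq_prod, integral_prod _ (hf.integrable_energy hh hk)]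
  simp_rw [mul_assoc, integral_const_mul]

lemma IsDensity.integrable_mul_pot (hf : IsDensity f) (hh : IsDensity h) (hk : IsKernel E k) :
    Integrable fun x => f x * pot k h x := by
  have := (hf.integrable_energy hh hk).integral_prod_left
  simpa only [pot, mul_assoc, integral_const_mul] using this

lemma energy_comm (k : ℝ → ℝ) (f h : E → ℝ) : energy k f h = energy k h f := by
  unfold energy
  rw [Measure.volume_eq_prod, ← integral_prod_swap]
  refine integral_congr_ae (ae_of_all _ fun p => ?_)
  simp only [Prod.fst_swap, Prod.snd_swap, norm_sub_rev p.2 p.1]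
  ring

lemma IsKernel.pot_nonneg (hk : IsKernel E k) (hf : IsDensity f) (x : E) : 0 ≤ pot k f x :=
  integral_nonneg fun _ => mul_nonneg (hf.nonneg _) (hk.nonneg _)

lemma isDensity_indicator {s : Set E} (hs : MeasurableSet s) (hfin : volume s ≠ ⊤) :
    IsDensity (s.indicator fun _ => (1 : ℝ)) where
  integrable := (integrable_indicator_iff hs).2 (integrableOn_const hfin)
  nonneg := indicator_nonneg fun _ _ => zero_le_one
  le_one := fun x => indicator_le_self' (f := fun _ => (1 : ℝ)) (fun _ _ => zero_le_one) x

lemma isDensity_ball (c : E) (r : ℝ) : IsDensity ((ball c r).indicator fun _ => (1 : ℝ)) :=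
  isDensity_indicator measurableSet_ball measure_ball_lt_top.ne

lemma integral_ball_indicator (c : E) (r : ℝ) :
    ∫ x, (ball c r).indicator (fun _ => (1 : ℝ)) x = volume.real (ball c r) :=
  integral_indicator_one measurableSet_ball

variable (E) in
/-- A reflection across an affine hyperplane, together with the signed (doubled) distance to that
hyperplane. -/
structure Mirror where
  refl : E → E
  side : E → ℝ
  measurePreserving : MeasurePreserving refl volume volume
  involutive : ∀ x, refl (refl x) = x
  norm_refl_sub_refl : ∀ x y, ‖refl x - refl y‖ = ‖x - y‖
  side_refl : ∀ x, side (refl x) = -side x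
  measurable_side : Measurable side
  norm_sub_refl_sq : ∀ x y, ‖x - refl y‖ ^ 2 = ‖x - y‖ ^ 2 + side x * side y

lemma exists_mirror {a b : E} (hab : a ≠ b) :
    ∃ S : Mirror E, S.refl a = b ∧ 0 < S.side a := by
  have hv : 0 < ‖b - a‖ := norm_pos_iff.2 (sub_ne_zero.2 hab.symm)
  set v := b - a with hvdef
  set e : E := ‖v‖⁻¹ • v with he
  have hee : ⟪e, e⟫ = 1 := by
    rw [he, real_inner_smul_left, real_inner_smul_right, real_inner_self_eq_norm_sq]
    field_simp
  set m : E := (2⁻¹ : ℝ) • (a + b) with hm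
  let L : E → ℝ := fun z => 2 * ⟪m - z, e⟫
  let T : E → E := fun z => z + L z • e
  have hLT : ∀ z, L (T z) = -L z := fun z => by
    simp only [L, T, ← sub_sub, inner_sub_left _ (_ • e), real_inner_smul_left, hee]
    ring
  have hLsub : ∀ x y, L x - L y = -2 * ⟪x - y, e⟫ := fun x y => by
    simp only [L, inner_sub_left]; ring
  have hTT : ∀ z, T (T z) = z := fun z => by
    change T z + L (T z) • e = z
    rw [hLT]; simp [T]
  have hiso : ∀ x y, ‖T x - T y‖ = ‖x - y‖ := fun x y => by
    have h1 : T x - T y = (x - y) + (L x - L y) • e := by simp only [T, sub_smul]; abel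
    have : ‖T x - T y‖ ^ 2 = ‖x - y‖ ^ 2 := by
      rw [h1, norm_add_sq_real, real_inner_smul_right, norm_smul, mul_pow,
        ← real_inner_self_eq_norm_sq e, hee, Real.norm_eq_abs, sq_abs, hLsub]
      ring
    exact (sq_eq_sq₀ (norm_nonneg _) (norm_nonneg _)).1 this
  have hcont : Continuous L := by fun_prop
  have hLa : L a = ‖v‖ := by
    have : m - a = (2⁻¹ : ℝ) • v := by
      rw [hm, hvdef]; module
    simp only [L, this, he, real_inner_smul_left, real_inner_smul_right,
      real_inner_self_eq_norm_sq]
    field_simp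
  have hsq : ∀ x y, ‖x - T y‖ ^ 2 = ‖x - y‖ ^ 2 + L x * L y := fun x y => by
    have h1 : x - T y = (x - y) - L y • e := by simp only [T]; abel
    have h2 : ⟪x - y, e⟫ = -(L x - L y) / 2 := by rw [hLsub]; ring
    rw [h1, norm_sub_sq_real, real_inner_smul_right, norm_smul, mul_pow,
      ← real_inner_self_eq_norm_sq e, hee, Real.norm_eq_abs, sq_abs, h2]
    ring
  have hTa : T a = b := by
    change a + L a • e = b
    rw [hLa, he, smul_smul, mul_inv_cancel₀ hv.ne', one_smul, hvdef]; abel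
  let I : E ≃ᵢ E :=
    { toFun := T, invFun := T, left_inv := hTT, right_inv := hTT
      isometry_toFun := Isometry.of_dist_eq fun x y => by simp only [dist_eq_norm, hiso] }
  have hmp : MeasurePreserving T volume volume := by
    let A := I.toRealAffineIsometryEquiv
    have hA : ∀ z, T z = A.linearIsometryEquiv z + T 0 := fun z => by
      have := A.map_vadd 0 z
      simpa [A, I] using this
    have h2 := (measurePreserving_add_right volume (T 0)).comp
      A.linearIsometryEquiv.measurePreserving
    rwa [show (fun x => x + T 0) ∘ A.linearIsometryEquiv = T from funext fun z => (hA z).symm] at h2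
  exact ⟨⟨T, L, hmp, hTT, hiso, hLT, hcont.measurable, hsq⟩, hTa, by simpa [hLa] using hv⟩

end Basic

section Polarization

variable {E : Type*} [NormedAddCommGroup E] [InnerProductSpace ℝ E] [FiniteDimensional ℝ E]
  [MeasurableSpace E] [BorelSpace E] {k : ℝ → ℝ} {f h : E → ℝ}

namespace Mirror

variable (S : Mirror E)

lemma norm_refl_sub (x y : E) : ‖S.refl x - y‖ = ‖x - S.refl y‖ := by
  rw [← S.norm_refl_sub_refl x (S.refl y), S.involutive]

lemma refl_eq_of_side_eq_zero {x : E} (hx : S.side x = 0) : S.refl x = x := by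
  have := S.norm_sub_refl_sq x x
  rw [hx, sub_self, norm_zero, mul_zero, zero_pow two_ne_zero, zero_add, sq_eq_zero_iff,
    norm_eq_zero, sub_eq_zero] at this
  exact this.symm

lemma norm_sub_le_iff (x y : E) : ‖x - y‖ ≤ ‖x - S.refl y‖ ↔ 0 ≤ S.side x * S.side y := by
  rw [← sq_le_sq₀ (norm_nonneg _) (norm_nonneg _), S.norm_sub_refl_sq]
  simp

lemma norm_sub_lt_iff (x y : E) : ‖x - y‖ < ‖x - S.refl y‖ ↔ 0 < S.side x * S.side y := by
  rw [← sq_lt_sq₀ (norm_nonneg _) (norm_nonneg _), S.norm_sub_refl_sq]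
  simp

/-- The difference of the kernel at `y` and at the reflection of `y`. -/
def kernelDiff (k : ℝ → ℝ) (x y : E) : ℝ := k ‖x - y‖ - k ‖x - S.refl y‖

lemma kernelDiff_nonneg (hk : IsKernel E k) {x y : E} (hxy : x ≠ y)
    (hs : 0 ≤ S.side x * S.side y) : 0 ≤ S.kernelDiff k x y := by
  have h1 := (S.norm_sub_le_iff x y).2 hs
  have h0 : 0 < ‖x - y‖ := norm_pos_iff.2 (sub_ne_zero.2 hxy)
  exact sub_nonneg.2 (hk.antitoneOn (mem_Ioi.2 h0) (mem_Ioi.2 (h0.trans_le h1)) h1)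

lemma kernelDiff_nonpos (hk : IsKernel E k) {x y : E} (hxy : x ≠ S.refl y)
    (hs : S.side x * S.side y ≤ 0) : S.kernelDiff k x y ≤ 0 := by
  have := S.kernelDiff_nonneg hk hxy (by rw [S.side_refl]; linarith)
  rw [kernelDiff, S.involutive] at this
  rw [kernelDiff]; linarith

lemma kernelDiff_pos (hk : StrictAntiOn k (Ioi 0)) {x y : E} (hxy : x ≠ y)
    (hs : 0 < S.side x * S.side y) : 0 < S.kernelDiff k x y := by
  have h1 := (S.norm_sub_lt_iff x y).2 hs
  have h0 : 0 < ‖x - y‖ := norm_pos_iff.2 (sub_ne_zero.2 hxy)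
  exact sub_pos.2 (hk (mem_Ioi.2 h0) (mem_Ioi.2 (h0.trans h1)) h1)

lemma kernelDiff_ne_zero (hk : StrictAntiOn k (Ioi 0)) {x y : E} (hxy : x ≠ y)
    (hxy' : x ≠ S.refl y) (hs : S.side x * S.side y ≠ 0) : S.kernelDiff k x y ≠ 0 := by
  rcases hs.lt_or_gt with h | h
  · have := S.kernelDiff_pos hk hxy' (by rw [S.side_refl]; linarith)
    rw [kernelDiff, S.involutive] at this
    rw [kernelDiff]; linarith
  · exact (S.kernelDiff_pos hk hxy h).ne'

lemma ae_ne [Nontrivial E] (x : E) : ∀ᵐ y : E, x ≠ y ∧ x ≠ S.refl y := by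
  have h1 : ∀ a : E, ∀ᵐ y : E, y ≠ a := fun a => compl_mem_ae_iff.2 (measure_singleton a)
  filter_upwards [h1 x, h1 (S.refl x)] with y hy hy'
  exact ⟨hy.symm, fun h => hy' (by rw [h, S.involutive])⟩

lemma ae_prod_ne [Nontrivial E] : ∀ᵐ p : E × E, p.1 ≠ p.2 ∧ p.1 ≠ S.refl p.2 := by
  have hm : Measurable S.refl := S.measurePreserving.measurable
  refine (Measure.ae_prod_iff_ae_ae ?_).2 (ae_of_all _ fun x => S.ae_ne x)
  exact ((measurableSet_eq_fun measurable_fst measurable_snd).compl).inter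
    ((measurableSet_eq_fun measurable_fst (hm.comp measurable_snd)).compl)

/-- The antisymmetrization of `f` for the reflection. -/
def antisymm (f : E → ℝ) (x : E) : ℝ := f x - f (S.refl x)

/-- The polarization of `f`: the larger value is put on the side where `S.side` is nonnegative. -/
noncomputable def polarize (f : E → ℝ) (x : E) : ℝ :=
  if 0 ≤ S.side x then max (f x) (f (S.refl x)) else min (f x) (f (S.refl x))

lemma polarize_add (f : E → ℝ) (x : E) :
    S.polarize f x + S.polarize f (S.refl x) = f x + f (S.refl x) := by
  unfold polarize
  rw [S.side_refl, S.involutive]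
  rcases lt_trichotomy (S.side x) 0 with hx | hx | hx
  · rw [if_neg (by linarith), if_pos (by linarith), max_comm, min_add_max]
  · have := S.refl_eq_of_side_eq_zero hx
    simp [hx, this]
  · rw [if_pos (by linarith), if_neg (by linarith), min_comm, max_add_min]

lemma antisymm_polarize_mul_side (f : E → ℝ) (x : E) :
    S.antisymm (S.polarize f) x * S.side x = |S.antisymm f x| * |S.side x| := by
  unfold antisymm polarize
  rw [S.side_refl, S.involutive]
  rcases lt_trichotomy (S.side x) 0 with hx | hx | hx
  · rw [if_neg (by linarith), if_pos (by linarith), max_comm, abs_of_neg hx, ← max_sub_min_eq_abs,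
      max_comm, min_comm]
    ring
  · simp [hx]
  · rw [if_pos (by linarith), if_neg (by linarith), abs_of_pos hx, ← max_sub_min_eq_abs,
      max_comm, min_comm]

lemma antisymm_eq_zero {x : E} (hx : S.side x = 0) (f : E → ℝ) : S.antisymm f x = 0 := by
  rw [antisymm, S.refl_eq_of_side_eq_zero hx, sub_self]

lemma abs_antisymm_polarize (f : E → ℝ) (x : E) :
    |S.antisymm (S.polarize f) x| = |S.antisymm f x| := by
  by_cases hx : S.side x = 0
  · simp [S.antisymm_eq_zero hx]
  · have := congrArg abs (S.antisymm_polarize_mul_side f x)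
    rw [abs_mul, abs_mul, abs_abs, abs_abs] at this
    exact mul_right_cancel₀ (abs_ne_zero.2 hx) this

end Mirror

lemma IsDensity.comp_refl (hf : IsDensity f) (S : Mirror E) : IsDensity (f ∘ S.refl) :=
  ⟨S.measurePreserving.integrable_comp_of_integrable hf.integrable, fun _ => hf.nonneg _,
    fun _ => hf.le_one _⟩

lemma IsDensity.polarize (hf : IsDensity f) (S : Mirror E) : IsDensity (S.polarize f) where
  integrable := by
    have hg := (hf.comp_refl S).integrable
    have hs : MeasurableSet {x | 0 ≤ S.side x} :=
      measurableSet_le measurable_const S.measurable_side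
    classical
    exact Integrable.piecewise hs (hf.integrable.sup hg).integrableOn
      (hf.integrable.inf hg).integrableOn
  nonneg x := by
    unfold Mirror.polarize
    split_ifs
    · exact le_max_of_le_left (hf.nonneg _)
    · exact le_min (hf.nonneg _) (hf.nonneg _)
  le_one x := by
    unfold Mirror.polarize
    split_ifs
    · exact max_le (hf.le_one _) (hf.le_one _)
    · exact min_le_of_left_le (hf.le_one _)

lemma Mirror.measurableEmbedding (S : Mirror E) : MeasurableEmbedding S.refl :=
  (⟨⟨S.refl, S.refl, S.involutive, S.involutive⟩, S.measurePreserving.measurable,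
    S.measurePreserving.measurable⟩ : E ≃ᵐ E).measurableEmbedding

lemma Mirror.integral_comp (S : Mirror E) (u : E → ℝ) : ∫ x, u (S.refl x) = ∫ x, u x :=
  S.measurePreserving.integral_comp S.measurableEmbedding u

lemma integral_polarize (hf : IsDensity f) (S : Mirror E) :
    ∫ x, S.polarize f x = ∫ x, f x := by
  have h1 := S.integral_comp f
  have h2 := S.integral_comp (S.polarize f)
  have h3 : ∫ x, (S.polarize f x + S.polarize f (S.refl x)) = ∫ x, (f x + f (S.refl x)) :=
    integral_congr_ae (ae_of_all _ fun x => S.polarize_add f x)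
  have h4 := integral_add (hf.polarize S).integrable ((hf.polarize S).comp_refl S).integrable
  have h5 := integral_add hf.integrable (hf.comp_refl S).integrable
  simp only [Function.comp] at h4 h5
  linarith

lemma pot_comp_refl (S : Mirror E) (k : ℝ → ℝ) (f : E → ℝ) (x : E) :
    pot k (f ∘ S.refl) x = pot k f (S.refl x) := by
  unfold pot
  rw [← S.integral_comp]
  refine integral_congr_ae (ae_of_all _ fun y => ?_)
  simp only [Function.comp, S.involutive, S.norm_refl_sub]

lemma Mirror.pot_eq (S : Mirror E) (hf : IsDensity f) (hk : IsKernel E k) (x : E) :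
    pot k f x = 2⁻¹ * ∫ y, (f y * k ‖x - y‖ + f (S.refl y) * k ‖x - S.refl y‖) := by
  have h1 := hf.integrable_mul_kernel hk x
  have h2 : Integrable fun y => f (S.refl y) * k ‖x - S.refl y‖ :=
    S.measurePreserving.integrable_comp_of_integrable h1
  have h3 := S.integral_comp fun y => f y * k ‖x - y‖
  rw [integral_add h1 h2, h3, pot]
  ring

lemma Mirror.integrable_antisymm_mul (S : Mirror E) (hf : IsDensity f) (hk : IsKernel E k) (x : E) :
    Integrable fun y => S.antisymm f y * S.kernelDiff k x y := by
  have h1 := (hf.integrable_mul_kernel hk x).sub ((hf.comp_refl S).integrable_mul_kernel hk x)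
  have h2 := (hf.integrable_mul_kernel hk (S.refl x)).sub
    ((hf.comp_refl S).integrable_mul_kernel hk (S.refl x))
  refine (h1.sub h2).congr (ae_of_all _ fun y => ?_)
  simp only [Pi.sub_apply, Mirror.antisymm, Mirror.kernelDiff, Function.comp, S.norm_refl_sub]
  ring

lemma Mirror.pot_sub_pot (S : Mirror E) (hf : IsDensity f) (hk : IsKernel E k) (x : E) :
    pot k f x - pot k f (S.refl x) = 2⁻¹ * ∫ y, S.antisymm f y * S.kernelDiff k x y := by
  have h1 := hf.integrable_mul_kernel hk x
  have h2 := (hf.comp_refl S).integrable_mul_kernel hk x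
  have h3 := hf.integrable_mul_kernel hk (S.refl x)
  have h4 := (hf.comp_refl S).integrable_mul_kernel hk (S.refl x)
  have h5 : ∫ y, S.antisymm f y * S.kernelDiff k x y =
      (pot k f x - pot k (f ∘ S.refl) x) -
        (pot k f (S.refl x) - pot k (f ∘ S.refl) (S.refl x)) := by
    unfold pot
    rw [← integral_sub' h1 h2, ← integral_sub' h3 h4, ← integral_sub' (h1.sub h2) (h3.sub h4)]
    refine integral_congr_ae (ae_of_all _ fun y => ?_)
    simp only [Pi.sub_apply, Mirror.antisymm, Mirror.kernelDiff, Function.comp, S.norm_refl_sub]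
    ring
  rw [h5, pot_comp_refl, pot_comp_refl, S.involutive]
  ring

/-- The integrand of `Mirror.pot_sub_pot` has a sign when `f` is larger on one side. -/
lemma Mirror.antisymm_mul_kernelDiff_nonneg [Nontrivial E] (S : Mirror E) (hk : IsKernel E k)
    {x : E} (hx : 0 < S.side x) (hf : ∀ᵐ y, 0 ≤ S.antisymm f y * S.side y) :
    ∀ᵐ y, 0 ≤ S.antisymm f y * S.kernelDiff k x y := by
  filter_upwards [hf, S.ae_ne x] with y hy hne
  rcases lt_trichotomy (S.side y) 0 with h0 | h0 | h0
  · exact mul_nonneg_of_nonpos_of_nonpos (nonpos_of_mul_nonneg_left hy h0)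
      (S.kernelDiff_nonpos hk hne.2 (mul_nonpos_of_nonneg_of_nonpos hx.le h0.le))
  · simp [S.antisymm_eq_zero h0]
  · exact mul_nonneg (nonneg_of_mul_nonneg_left hy h0)
      (S.kernelDiff_nonneg hk hne.1 (mul_nonneg hx.le h0.le))

lemma Mirror.pot_refl_le [Nontrivial E] (S : Mirror E) (hf : IsDensity f) (hk : IsKernel E k)
    {x : E} (hx : 0 < S.side x) (hfS : ∀ᵐ y, 0 ≤ S.antisymm f y * S.side y) :
    pot k f (S.refl x) ≤ pot k f x := by
  have h1 := S.pot_sub_pot hf hk x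
  have h2 := integral_nonneg_of_ae (S.antisymm_mul_kernelDiff_nonneg hk hx hfS)
  linarith

lemma Mirror.antisymm_eq_zero_of_pot_eq [Nontrivial E] (S : Mirror E) (hf : IsDensity f)
    (hk : IsKernel E k) (hk' : StrictAntiOn k (Ioi 0)) {x : E} (hx : 0 < S.side x)
    (hfS : ∀ᵐ y, 0 ≤ S.antisymm f y * S.side y) (heq : pot k f x ≤ pot k f (S.refl x)) :
    ∀ᵐ y, S.antisymm f y = 0 := by
  have h1 := S.pot_sub_pot hf hk x
  have h3 := S.antisymm_mul_kernelDiff_nonneg hk hx hfS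
  have h2 := integral_nonneg_of_ae h3
  have h4 := (integral_eq_zero_iff_of_nonneg_ae h3 (S.integrable_antisymm_mul hf hk x)).1
    (by linarith)
  filter_upwards [h4, S.ae_ne x] with y hy hne
  by_cases h0 : S.side y = 0
  · exact S.antisymm_eq_zero h0 f
  · exact (mul_eq_zero.1 hy).resolve_right
      (S.kernelDiff_ne_zero hk' hne.1 hne.2 (mul_ne_zero hx.ne' h0))

lemma pot_refl_eq_of_antisymm_eq_zero (S : Mirror E) (hf : IsDensity f)
    (hk : IsKernel E k) (hfS : ∀ᵐ y, S.antisymm f y = 0) (x : E) :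
    pot k f (S.refl x) = pot k f x := by
  have h1 := S.pot_sub_pot hf hk x
  have h2 : ∫ y, S.antisymm f y * S.kernelDiff k x y = 0 := by
    refine integral_eq_zero_of_ae ?_
    filter_upwards [hfS] with y hy
    simp [hy]
  rw [h2] at h1; linarith

lemma Mirror.polarize_sub_mul_side_nonneg (S : Mirror E) (f : E → ℝ) (y : E) :
    0 ≤ (S.polarize f y - f y) * S.side y := by
  unfold Mirror.polarize
  split_ifs with h0
  · exact mul_nonneg (sub_nonneg.2 (le_max_left _ _)) h0
  · exact mul_nonneg_of_nonpos_of_nonpos (sub_nonpos.2 (min_le_left _ _)) (not_le.1 h0).le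

lemma Mirror.polarize_sub_eq (S : Mirror E) (f : E → ℝ) (y : E) :
    S.polarize f y - f y = 2⁻¹ * (S.antisymm (S.polarize f) y - S.antisymm f y) := by
  have := S.polarize_add f y
  unfold Mirror.antisymm
  linarith

lemma Mirror.pot_polarize_sub (S : Mirror E) (hf : IsDensity f) (hk : IsKernel E k) (x : E) :
    Integrable (fun y => (S.polarize f y - f y) * S.kernelDiff k x y) ∧
    pot k (S.polarize f) x - pot k f x =
      2⁻¹ * ∫ y, (S.polarize f y - f y) * S.kernelDiff k x y := by
  have hp := hf.polarize S
  have h1 := S.integrable_antisymm_mul hf hk x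
  have h2 := S.integrable_antisymm_mul hp hk x
  have h3 : ∀ y, (S.polarize f y - f y) * S.kernelDiff k x y =
      2⁻¹ * (S.antisymm (S.polarize f) y * S.kernelDiff k x y -
        S.antisymm f y * S.kernelDiff k x y) := fun y => by
    rw [S.polarize_sub_eq]; ring
  refine ⟨((h2.sub h1).const_mul 2⁻¹).congr (ae_of_all _ fun y => (h3 y).symm), ?_⟩
  have hi : ∀ {u : E → ℝ}, IsDensity u →
      Integrable fun y => u y * k ‖x - y‖ + u (S.refl y) * k ‖x - S.refl y‖ := fun hu =>
    (hu.integrable_mul_kernel hk x).add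
      (S.measurePreserving.integrable_comp_of_integrable (hu.integrable_mul_kernel hk x))
  rw [S.pot_eq hf hk, S.pot_eq hp hk, ← mul_sub, ← integral_sub (hi hp) (hi hf)]
  congr 1
  refine integral_congr_ae (ae_of_all _ fun y => ?_)
  have := S.polarize_add f y
  have h5 : S.polarize f (S.refl y) = f y + f (S.refl y) - S.polarize f y := by linarith
  simp only [Mirror.kernelDiff, h5]
  ring

lemma Mirror.pot_polarize [Nontrivial E] (S : Mirror E) (hf : IsDensity f) (hk : IsKernel E k)
    (hk' : StrictAntiOn k (Ioi 0)) {x : E} (hx : 0 < S.side x) :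
    pot k f x ≤ pot k (S.polarize f) x ∧
      (pot k (S.polarize f) x ≤ pot k f x → ∀ᵐ y, 0 ≤ S.antisymm f y * S.side y) := by
  obtain ⟨hint, heq⟩ := S.pot_polarize_sub hf hk x
  have h3 : ∀ᵐ y, 0 ≤ (S.polarize f y - f y) * S.kernelDiff k x y := by
    filter_upwards [S.ae_ne x] with y hne
    have hy := S.polarize_sub_mul_side_nonneg f y
    rcases lt_trichotomy (S.side y) 0 with h0 | h0 | h0
    · exact mul_nonneg_of_nonpos_of_nonpos (nonpos_of_mul_nonneg_left hy h0)
        (S.kernelDiff_nonpos hk hne.2 (mul_nonpos_of_nonneg_of_nonpos hx.le h0.le))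
    · simp [S.polarize_sub_eq, S.antisymm_eq_zero h0]
    · exact mul_nonneg (nonneg_of_mul_nonneg_left hy h0)
        (S.kernelDiff_nonneg hk hne.1 (mul_nonneg hx.le h0.le))
  have h2 := integral_nonneg_of_ae h3
  refine ⟨by linarith, fun hle => ?_⟩
  have h4 := (integral_eq_zero_iff_of_nonneg_ae h3 hint).1 (by linarith)
  filter_upwards [h4, S.ae_ne x] with y hy hne
  by_cases h0 : S.side y = 0
  · simp [h0]
  · have h5 := (mul_eq_zero.1 hy).resolve_right
      (S.kernelDiff_ne_zero hk' hne.1 hne.2 (mul_ne_zero hx.ne' h0))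
    rw [S.polarize_sub_eq] at h5
    rw [show S.antisymm f y = S.antisymm (S.polarize f) y by linarith,
      S.antisymm_polarize_mul_side]
    positivity

/-- The energy density symmetrized over the reflections of both variables. -/
def Mirror.symmIntegrand (S : Mirror E) (k : ℝ → ℝ) (f : E → ℝ) (p : E × E) : ℝ :=
  (f p.1 * f p.2 + f (S.refl p.1) * f (S.refl p.2)) * k ‖p.1 - p.2‖ +
    (f p.1 * f (S.refl p.2) + f (S.refl p.1) * f p.2) * k ‖p.1 - S.refl p.2‖

lemma Mirror.integral_symmIntegrand (S : Mirror E) (hf : IsDensity f) (hk : IsKernel E k) :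
    Integrable (S.symmIntegrand k f) ∧ ∫ p, S.symmIntegrand k f p = 4 * energy k f f := by
  let G : E × E → ℝ := fun p => f p.1 * f p.2 * k ‖p.1 - p.2‖
  have hG : Integrable G := hf.integrable_energy hf hk
  have hid : MeasurePreserving (id : E → E) volume volume := MeasurePreserving.id _
  have hs := S.measurePreserving
  have he := S.measurableEmbedding
  have m1 : MeasurePreserving (Prod.map S.refl S.refl) (volume : Measure (E × E)) volume :=
    hs.prod hs
  have m2 : MeasurePreserving (Prod.map id S.refl) (volume : Measure (E × E)) volume :=
    hid.prod hs
  have m3 : MeasurePreserving (Prod.map S.refl id) (volume : Measure (E × E)) volume :=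
    hs.prod hid
  have i1 := m1.integrable_comp_of_integrable hG
  have i2 := m2.integrable_comp_of_integrable hG
  have i3 := m3.integrable_comp_of_integrable hG
  have e1 := m1.integral_comp (he.prodMap he) G
  have e2 := m2.integral_comp (MeasurableEmbedding.id.prodMap he) G
  have e3 := m3.integral_comp (he.prodMap MeasurableEmbedding.id) G
  have heq : S.symmIntegrand k f = G + G ∘ Prod.map S.refl S.refl +
      G ∘ Prod.map id S.refl + G ∘ Prod.map S.refl id := by
    funext p
    simp only [Pi.add_apply, Mirror.symmIntegrand, G, Function.comp, Prod.map, id,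
      S.norm_refl_sub_refl,
      S.norm_refl_sub]
    ring
  rw [heq]
  have i12 := hG.add i1
  have i123 := i12.add i2
  refine ⟨i123.add i3, ?_⟩
  rw [integral_add' i123 i3, integral_add' i12 i2, integral_add' hG i1]
  simp only [Function.comp] at e1 e2 e3 ⊢
  rw [e1, e2, e3]
  rw [show energy k f f = ∫ p, G p from rfl]
  ring

lemma Mirror.symmIntegrand_polarize_sub (S : Mirror E) (k : ℝ → ℝ) (f : E → ℝ) (p : E × E) :
    S.symmIntegrand k (S.polarize f) p - S.symmIntegrand k f p = 2⁻¹ * S.kernelDiff k p.1 p.2 *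
      (S.antisymm (S.polarize f) p.1 * S.antisymm (S.polarize f) p.2 -
        S.antisymm f p.1 * S.antisymm f p.2) := by
  have h1 := S.polarize_add f p.1
  have h2 := S.polarize_add f p.2
  have h3 : S.polarize f (S.refl p.1) = f p.1 + f (S.refl p.1) - S.polarize f p.1 := by linarith
  have h4 : S.polarize f (S.refl p.2) = f p.2 + f (S.refl p.2) - S.polarize f p.2 := by linarith
  simp only [Mirror.symmIntegrand, Mirror.kernelDiff, Mirror.antisymm, h3, h4]
  ring

lemma Mirror.symmIntegrand_le [Nontrivial E] (S : Mirror E) (hk : IsKernel E k) (f : E → ℝ) :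
    ∀ᵐ p, 0 ≤ S.symmIntegrand k (S.polarize f) p - S.symmIntegrand k f p := by
  filter_upwards [S.ae_prod_ne] with p hne
  rw [S.symmIntegrand_polarize_sub]
  have h1 := S.antisymm_polarize_mul_side f p.1
  have h2 := S.antisymm_polarize_mul_side f p.2
  set a := S.antisymm (S.polarize f) p.1
  set b := S.antisymm (S.polarize f) p.2
  have hab : |S.antisymm f p.1 * S.antisymm f p.2| = |a * b| := by
    rw [abs_mul, abs_mul, S.abs_antisymm_polarize, S.abs_antisymm_polarize]
  have hsgn : 0 ≤ a * b * (S.side p.1 * S.side p.2) := by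
    rw [show a * b * (S.side p.1 * S.side p.2) = (a * S.side p.1) * (b * S.side p.2) by ring,
      h1, h2]
    positivity
  rcases lt_trichotomy (S.side p.1 * S.side p.2) 0 with h0 | h0 | h0
  · have h3 := nonpos_of_mul_nonneg_left hsgn h0
    have h4 := S.kernelDiff_nonpos hk hne.2 h0.le
    rw [abs_of_nonpos h3] at hab
    nlinarith [neg_abs_le (S.antisymm f p.1 * S.antisymm f p.2)]
  · have hz : ∀ u : E → ℝ, S.antisymm u p.1 * S.antisymm u p.2 = 0 := fun u => by
      rcases mul_eq_zero.1 h0 with h | h <;> simp [S.antisymm_eq_zero h]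
    rw [hz f, hz (S.polarize f)]; simp
  · have h3 := nonneg_of_mul_nonneg_left hsgn h0
    have h4 := S.kernelDiff_nonneg hk hne.1 h0.le
    rw [abs_of_nonneg h3] at hab
    have := le_abs_self (S.antisymm f p.1 * S.antisymm f p.2)
    exact mul_nonneg (by positivity) (by linarith)

lemma Mirror.energy_le_polarize [Nontrivial E] (S : Mirror E) (hf : IsDensity f)
    (hk : IsKernel E k) : energy k f f ≤ energy k (S.polarize f) (S.polarize f) := by
  obtain ⟨i1, e1⟩ := S.integral_symmIntegrand hf hk
  obtain ⟨i2, e2⟩ := S.integral_symmIntegrand (hf.polarize S) hk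
  have := integral_nonneg_of_ae (S.symmIntegrand_le hk f)
  rw [integral_sub i2 i1, e1, e2] at this
  linarith

/-- If polarization does not increase the energy, then `f` is larger on one of the two sides. -/
lemma Mirror.antisymm_sign_of_energy_eq [Nontrivial E] (S : Mirror E) (hf : IsDensity f)
    (hk : IsKernel E k) (hk' : StrictAntiOn k (Ioi 0))
    (heq : energy k (S.polarize f) (S.polarize f) ≤ energy k f f) :
    (∀ᵐ y, 0 ≤ S.antisymm f y * S.side y) ∨ ∀ᵐ y, S.antisymm f y * S.side y ≤ 0 := by
  obtain ⟨i1, e1⟩ := S.integral_symmIntegrand hf hk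
  obtain ⟨i2, e2⟩ := S.integral_symmIntegrand (hf.polarize S) hk
  have h1 := S.symmIntegrand_le hk f
  have h2 := integral_nonneg_of_ae h1
  have h3 : ∫ p, (S.symmIntegrand k (S.polarize f) p - S.symmIntegrand k f p) ≤ 0 := by
    rw [integral_sub i2 i1, e1, e2]; linarith
  have h4 := (integral_eq_zero_iff_of_nonneg_ae h1 (i2.sub i1)).1 (le_antisymm h3 h2)
  have h5 : ∀ᵐ p : E × E,
      0 ≤ (S.antisymm f p.1 * S.side p.1) * (S.antisymm f p.2 * S.side p.2) := by
    filter_upwards [h4, S.ae_prod_ne] with p hp hne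
    by_cases h0 : S.side p.1 * S.side p.2 = 0
    · rcases mul_eq_zero.1 h0 with h | h <;> simp [h]
    · have h6 := S.symmIntegrand_polarize_sub k f p
      have hp' : S.symmIntegrand k (S.polarize f) p - S.symmIntegrand k f p = 0 := hp
      rw [hp'] at h6
      have h7 := (mul_eq_zero.1 h6.symm).resolve_left
        (mul_ne_zero (by norm_num) (S.kernelDiff_ne_zero hk' hne.1 hne.2 h0))
      calc (0 : ℝ) ≤ (|S.antisymm f p.1| * |S.side p.1|) * (|S.antisymm f p.2| * |S.side p.2|) := by
            positivity
        _ = (S.antisymm (S.polarize f) p.1 * S.antisymm (S.polarize f) p.2) *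
            (S.side p.1 * S.side p.2) := by
            rw [← S.antisymm_polarize_mul_side, ← S.antisymm_polarize_mul_side]; ring
        _ = (S.antisymm f p.1 * S.antisymm f p.2) * (S.side p.1 * S.side p.2) := by
            rw [sub_eq_zero.1 h7]
        _ = _ := by ring
  rw [Measure.volume_eq_prod] at h5
  have h6 := Measure.ae_ae_of_ae_prod h5
  by_cases hz : ∀ᵐ y, S.antisymm f y * S.side y = 0
  · exact Or.inl (hz.mono fun y hy => hy.ge)
  · obtain ⟨x, hx, hx0⟩ := ((not_eventually.1 hz).and_eventually h6).exists
    rcases lt_or_gt_of_ne hx with hneg | hpos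
    · exact Or.inr (hx0.mono fun y hy => nonpos_of_mul_nonneg_right hy hneg)
    · exact Or.inl (hx0.mono fun y hy => nonneg_of_mul_nonneg_right hy hpos)

end Polarization

section Bathtub

variable {E : Type*} [NormedAddCommGroup E] [InnerProductSpace ℝ E] [FiniteDimensional ℝ E]
  [MeasurableSpace E] [BorelSpace E] [Nontrivial E] {k : ℝ → ℝ} {f : E → ℝ} {c : E} {r : ℝ}

/-- The bathtub principle for radially nonincreasing functions. -/
lemma integral_mul_le_of_radial {V : E → ℝ} (hf : IsDensity f) (hr : 0 ≤ r)
    (hm : ∫ x, f x = volume.real (ball c r))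
    (hV : ∀ x y, ‖x - c‖ < ‖y - c‖ → V y ≤ V x)
    (hfV : Integrable fun x => f x * V x)
    (hbV : Integrable fun x => (ball c r).indicator (fun _ => (1 : ℝ)) x * V x) :
    ∫ x, f x * V x ≤ ∫ x, (ball c r).indicator (fun _ => (1 : ℝ)) x * V x ∧
    ((∀ x y, ‖x - c‖ < ‖y - c‖ → V y < V x) →
      ∫ x, (ball c r).indicator (fun _ => (1 : ℝ)) x * V x ≤ ∫ x, f x * V x →
      f =ᵐ[volume] (ball c r).indicator fun _ => (1 : ℝ)) := by
  obtain ⟨w, hw⟩ := exists_norm_eq E hr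
  set z := c + w
  have hz : ‖z - c‖ = r := by simp [z, hw]
  set χ : E → ℝ := (ball c r).indicator fun _ => (1 : ℝ) with hχ
  have hχd : IsDensity χ := isDensity_ball c r
  have hsphere : ∀ᵐ x : E, ‖x - c‖ ≠ r := by
    have : ∀ᵐ x : E, x ∉ sphere c r :=
      measure_eq_zero_iff_ae_notMem.1 (Measure.addHaar_sphere volume c r)
    filter_upwards [this] with x hx h
    exact hx (by rwa [mem_sphere, dist_eq_norm])
  have hin : ∀ x, ‖x - c‖ < r → χ x = 1 := fun x hx =>
    indicator_of_mem (by rwa [mem_ball, dist_eq_norm]) _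
  have hout : ∀ x, r < ‖x - c‖ → χ x = 0 := fun x hx =>
    indicator_of_notMem (by rw [mem_ball, dist_eq_norm]; exact hx.not_gt) _
  have h0 : ∀ᵐ x, 0 ≤ (χ x - f x) * (V x - V z) := by
    filter_upwards [hsphere] with x hx
    rcases hx.lt_or_gt with h | h
    · rw [hin x h]
      exact mul_nonneg (sub_nonneg.2 (hf.le_one x)) (sub_nonneg.2 (hV x z (by rwa [hz])))
    · rw [hout x h, zero_sub]
      exact mul_nonneg_of_nonpos_of_nonpos (neg_nonpos.2 (hf.nonneg x))
        (sub_nonpos.2 (hV z x (by rwa [hz])))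
  have hi1 := hbV.sub hfV
  have hi2 := (hχd.integrable.sub hf.integrable).mul_const (V z)
  have heq : (fun x => (χ x - f x) * (V x - V z)) =
      (((fun x => χ x * V x) - fun x => f x * V x) - fun x => (χ - f) x * V z) := by
    funext x; simp only [Pi.sub_apply]; ring
  have hint : ∫ x, (χ x - f x) * (V x - V z) = (∫ x, χ x * V x) - ∫ x, f x * V x := by
    rw [heq, integral_sub' hi1 hi2, integral_sub' hbV hfV, integral_mul_const,
      integral_sub' hχd.integrable hf.integrable, hm, hχ, integral_ball_indicator]
    ring
  have h1 := integral_nonneg_of_ae h0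
  refine ⟨by linarith, fun hstrict hle => ?_⟩
  have h2 := (integral_eq_zero_iff_of_nonneg_ae h0 (by rw [heq]; exact hi1.sub hi2)).1
    (by linarith)
  filter_upwards [h2, hsphere] with x hx hxr
  refine (sub_eq_zero.1 ((mul_eq_zero.1 hx).resolve_right (sub_ne_zero.2 ?_))).symm
  rcases hxr.lt_or_gt with h | h
  · exact (hstrict x z (by rwa [hz])).ne'
  · exact (hstrict z x (by rwa [hz])).ne

omit [Nontrivial E] in
lemma Mirror.side_pos_of_norm_sub_lt (S : Mirror E) {x : E} (hx : 0 < S.side x)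
    (h : ‖x - c‖ < ‖S.refl x - c‖) : 0 < S.side c := by
  rw [norm_sub_rev x, norm_sub_rev _ c, S.norm_sub_lt_iff] at h
  exact pos_of_mul_pos_left h hx.le

lemma pot_le_pot_of_mirrors (hf : IsDensity f) (hk : IsKernel E k)
    (hS : ∀ S : Mirror E, 0 < S.side c → ∀ᵐ y, 0 ≤ S.antisymm f y * S.side y)
    (x y : E) (hxy : ‖x - c‖ < ‖y - c‖) : pot k f y ≤ pot k f x := by
  obtain ⟨S, rfl, hpos⟩ := exists_mirror (a := x) (b := y) (by rintro rfl; exact lt_irrefl _ hxy)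
  exact S.pot_refl_le hf hk hpos (hS S (S.side_pos_of_norm_sub_lt hpos hxy))

omit [Nontrivial E] in
lemma Mirror.antisymm_ball_mul_side_nonneg (S : Mirror E) (hc : 0 < S.side c) (r : ℝ) (y : E) :
    0 ≤ S.antisymm ((ball c r).indicator fun _ => (1 : ℝ)) y * S.side y := by
  have hmono : ∀ y, 0 ≤ S.side y → (ball c r).indicator (fun _ => (1 : ℝ)) (S.refl y) ≤
      (ball c r).indicator (fun _ => (1 : ℝ)) y := fun y hy => by
    by_cases h : S.refl y ∈ ball c r
    · have h1 := (S.norm_sub_le_iff c y).2 (mul_nonneg hc.le hy)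
      have h2 : y ∈ ball c r := by
        rw [mem_ball', dist_eq_norm] at h ⊢
        exact h1.trans_lt h
      rw [indicator_of_mem h, indicator_of_mem h2]
    · rw [indicator_of_notMem h]
      exact indicator_nonneg (fun _ _ => zero_le_one) _
  rcases le_total 0 (S.side y) with hy | hy
  · exact mul_nonneg (sub_nonneg.2 (hmono y hy)) hy
  · have h1 := hmono (S.refl y) (by rw [S.side_refl]; linarith)
    rw [S.involutive] at h1
    exact mul_nonneg_of_nonpos_of_nonpos (sub_nonpos.2 h1) hy

lemma energy_le_ball_of_radial (hf : IsDensity f) (hk : IsKernel E k) (hr : 0 ≤ r)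
    (hm : ∫ x, f x = volume.real (ball c r))
    (hV : ∀ x y, ‖x - c‖ < ‖y - c‖ → pot k f y ≤ pot k f x) :
    energy k f f ≤ energy k ((ball c r).indicator fun _ => 1) ((ball c r).indicator fun _ => 1) ∧
    ((∀ x y, ‖x - c‖ < ‖y - c‖ → pot k f y < pot k f x) →
      energy k ((ball c r).indicator fun _ => 1) ((ball c r).indicator fun _ => 1) ≤
        energy k f f → f =ᵐ[volume] (ball c r).indicator fun _ => (1 : ℝ)) := by
  have hχ : IsDensity ((ball c r).indicator fun _ => (1 : ℝ)) := isDensity_ball c r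
  obtain ⟨h1, h1'⟩ := integral_mul_le_of_radial hf hr hm hV (hf.integrable_mul_pot hf hk)
    (hχ.integrable_mul_pot hf hk)
  obtain ⟨h2, -⟩ := integral_mul_le_of_radial hf hr hm
    (pot_le_pot_of_mirrors (k := k) hχ hk
      fun S hS => ae_of_all _ fun y => S.antisymm_ball_mul_side_nonneg hS r y)
    (hf.integrable_mul_pot hχ hk) (hχ.integrable_mul_pot hχ hk)
  rw [← energy_eq_integral_pot hf hf hk, ← energy_eq_integral_pot hχ hf hk] at h1 h1'
  rw [← energy_eq_integral_pot hf hχ hk, ← energy_eq_integral_pot hχ hχ hk, energy_comm] at h2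
  exact ⟨h1.trans h2, fun hs hle => h1' hs (h2.trans hle)⟩

end Bathtub

section Existence

variable {E : Type*} [NormedAddCommGroup E] [InnerProductSpace ℝ E] [FiniteDimensional ℝ E]
  [MeasurableSpace E] [BorelSpace E] {k : ℝ → ℝ}

lemma memLp_two_ball_indicator {h : E → ℝ} (hh : AEStronglyMeasurable h) {C : ℝ}
    (hC : ∀ x, |h x| ≤ C) (R : ℝ) : MemLp ((ball (0 : E) R).indicator h) 2 := by
  rw [memLp_indicator_iff_restrict measurableSet_ball]
  have : IsFiniteMeasure (volume.restrict (ball (0 : E) R)) :=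
    ⟨by simpa using measure_ball_lt_top⟩
  exact MemLp.of_bound hh.restrict C (ae_of_all _ hC)

/-- Densities supported in a fixed ball are sequentially weakly compact. -/
lemma exists_weak_limit {R : ℝ} {f : ℕ → E → ℝ} (hf : ∀ n, IsDensity (f n))
    (hsupp : ∀ n x, x ∉ ball (0 : E) R → f n x = 0) :
    ∃ g : E → ℝ, IsDensity g ∧ (∀ x, x ∉ ball (0 : E) R → g x = 0) ∧
      ∃ φ : ℕ → ℕ, StrictMono φ ∧ ∀ h : E → ℝ, AEStronglyMeasurable h →
        (∃ C, ∀ x, |h x| ≤ C) →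
        Tendsto (fun n => ∫ x, f (φ n) x * h x) atTop (𝓝 (∫ x, g x * h x)) := by
  set B := ball (0 : E) R
  have hind : ∀ n, B.indicator (f n) = f n := fun n =>
    indicator_eq_self.2 fun x hx => by_contra fun h => hx (hsupp n x h)
  have habs : ∀ n x, |f n x| ≤ 1 := fun n x => by
    rw [abs_of_nonneg ((hf n).nonneg x)]; exact (hf n).le_one x
  have hL : ∀ n, MemLp (f n) 2 := fun n => by
    have := memLp_two_ball_indicator (hf n).integrable.aestronglyMeasurable (habs n) R
    rwa [hind n] at this
  let F : ℕ → Lp ℝ 2 (volume : Measure E) := fun n => (hL n).toLp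
  have hinner : ∀ (u : Lp ℝ 2 (volume : Measure E)) {h : E → ℝ} (hh : MemLp h 2),
      ⟪u, hh.toLp⟫ = ∫ x, u x * h x := fun u h hh => by
    rw [L2.inner_def]
    refine integral_congr_ae ?_
    filter_upwards [hh.coeFn_toLp] with x hx
    simp [hx, mul_comm]
  have hFinner : ∀ n {h : E → ℝ} (hh : MemLp h 2), ⟪F n, hh.toLp⟫ = ∫ x, f n x * h x :=
    fun n h hh => by
      rw [hinner]
      refine integral_congr_ae ?_
      filter_upwards [(hL n).coeFn_toLp] with x hx
      rw [hx]
  have hnorm : ∀ n, ‖F n‖ ≤ √(volume.real B) := fun n => by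
    refine Real.le_sqrt_of_sq_le ?_
    rw [← real_inner_self_eq_norm_sq, hFinner n (hL n), ← integral_ball_indicator]
    have hB : IsDensity (B.indicator fun _ => (1 : ℝ)) := isDensity_ball 0 R
    refine integral_mono_of_nonneg (ae_of_all _ fun x => mul_self_nonneg _) hB.integrable
      (ae_of_all _ fun x => ?_)
    by_cases hx : x ∈ B
    · have h1 := (hf n).nonneg x
      have h2 := (hf n).le_one x
      rw [indicator_of_mem hx]
      nlinarith
    · simp [hsupp n x hx, indicator_of_notMem (show x ∉ ball 0 R from hx)]
  let ψ : ℕ → WeakDual ℝ (Lp ℝ 2 (volume : Measure E)) := fun n =>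
    StrongDual.toWeakDual (InnerProductSpace.toDual ℝ _ (F n))
  have hψ : ∀ n, ψ n ∈ WeakDual.toStrongDual ⁻¹' closedBall
      (0 : StrongDual ℝ (Lp ℝ 2 (volume : Measure E))) √(volume.real B) := fun n => by
    have : ‖InnerProductSpace.toDual ℝ _ (F n)‖ ≤ √(volume.real B) := by
      rw [LinearIsometryEquiv.norm_map]; exact hnorm n
    exact mem_closedBall_zero_iff.2 this
  have : Fact ((2 : ENNReal) ≠ ⊤) := ⟨by norm_num⟩
  obtain ⟨a, -, φ, hφ, hlim⟩ := WeakDual.isSeqCompact_closedBall (𝕜 := ℝ)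
    (E := Lp ℝ 2 (volume : Measure E)) 0 _ hψ
  let G : Lp ℝ 2 (volume : Measure E) :=
    (InnerProductSpace.toDual ℝ _).symm (WeakDual.toStrongDual a)
  have hG : ∀ {h : E → ℝ} (hh : MemLp h 2),
      Tendsto (fun n => ∫ x, f (φ n) x * h x) atTop (𝓝 (∫ x, G x * h x)) := fun {h} hh => by
    have h1 := ((WeakDual.eval_continuous hh.toLp).tendsto a).comp hlim
    have h2 : a hh.toLp = ∫ x, G x * h x := by
      rw [← hinner G hh, ← InnerProductSpace.toDual_apply_apply (𝕜 := ℝ)]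
      simp [G]
    rw [h2] at h1
    refine h1.congr fun n => ?_
    rw [← hFinner (φ n) hh]
    rfl
  have hGset : ∀ s, MeasurableSet s → volume s < ⊤ →
      IntegrableOn G s ∧ Tendsto (fun n => ∫ x in s, f (φ n) x) atTop (𝓝 (∫ x in s, G x)) :=
    fun s hs hfin => by
      have hs2 : MemLp (s.indicator fun _ => (1 : ℝ)) 2 :=
        memLp_indicator_const 2 hs 1 (Or.inr hfin.ne)
      have h3 : ∀ u : E → ℝ, (fun x => u x * s.indicator (fun _ => (1 : ℝ)) x) = s.indicator u :=
        fun u => by funext x; by_cases hx : x ∈ s <;> simp [hx]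
      have h4 := hG hs2
      simp only [h3, integral_indicator hs] at h4
      have : IsFiniteMeasure (volume.restrict s) := ⟨by simpa using hfin⟩
      exact ⟨((Lp.memLp G).restrict s).integrable one_le_two, h4⟩
  have hG0 : 0 ≤ᵐ[volume] G := ae_nonneg_of_forall_setIntegral_nonneg_of_sigmaFinite
    (fun s hs hfin => (hGset s hs hfin).1) fun s hs hfin =>
      ge_of_tendsto' (hGset s hs hfin).2 fun n => integral_nonneg fun x => (hf _).nonneg x
  have hG1 : 0 ≤ᵐ[volume] fun x => 1 - G x :=
    ae_nonneg_of_forall_setIntegral_nonneg_of_sigmaFinite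
      (fun s hs hfin => (integrableOn_const hfin.ne).sub (hGset s hs hfin).1) fun s hs hfin => by
        have h5 : ∫ x in s, (1 - G x) = (∫ x in s, (1 : ℝ)) - ∫ x in s, G x :=
          integral_sub (integrableOn_const hfin.ne) (hGset s hs hfin).1
        rw [h5, sub_nonneg]
        exact le_of_tendsto' (hGset s hs hfin).2 fun n => setIntegral_mono
          (hf _).integrable.integrableOn (integrableOn_const hfin.ne) fun x => (hf _).le_one x
  let g : E → ℝ := B.indicator fun x => max 0 (min (G x) 1)
  have hgG : ∀ᵐ x, g x = B.indicator G x := by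
    filter_upwards [hG0, hG1] with x h0 h1
    by_cases hx : x ∈ B
    · simp only [g, indicator_of_mem hx]
      rw [min_eq_left (by simpa using h1), max_eq_right (show 0 ≤ G x from h0)]
    · simp [g, hx]
  have hB2 : ∀ {h : E → ℝ}, AEStronglyMeasurable h → (∃ C, ∀ x, |h x| ≤ C) →
      MemLp (B.indicator h) 2 := fun hh ⟨C, hC⟩ => memLp_two_ball_indicator hh hC R
  refine ⟨g, ⟨?_, ?_, ?_⟩, fun x hx => indicator_of_notMem hx _, φ, hφ, fun h hh hC => ?_⟩
  · refine Integrable.congr ?_ (hgG.mono fun x hx => hx.symm)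
    exact (integrable_indicator_iff measurableSet_ball).2
      (hGset B measurableSet_ball measure_ball_lt_top).1
  · exact indicator_nonneg fun x _ => le_max_left _ _
  · intro x
    exact indicator_apply_le' (fun _ => max_le zero_le_one (min_le_right _ _)) fun _ => zero_le_one
  · have h6 := hG (hB2 hh hC)
    have h7 : ∫ x, g x * h x = ∫ x, G x * B.indicator h x := by
      refine integral_congr_ae (hgG.mono fun x hx => ?_)
      simp only [hx]
      by_cases hxB : x ∈ B <;> simp [hxB]
    rw [h7]
    refine h6.congr fun n => integral_congr_ae (ae_of_all _ fun x => ?_)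
    by_cases hxB : x ∈ B
    · simp [hxB]
    · simp [hxB, hsupp _ x hxB]

end Existence

section BoundedKernel

variable {E : Type*} [NormedAddCommGroup E] [InnerProductSpace ℝ E] [FiniteDimensional ℝ E]
  [MeasurableSpace E] [BorelSpace E] {k : ℝ → ℝ} {f : E → ℝ} {C m R r ε : ℝ}

lemma aestronglyMeasurable_pot (hf : IsDensity f) (hk : IsKernel E k) :
    AEStronglyMeasurable (pot k f) := by
  have : AEStronglyMeasurable (fun p : E × E => f p.2 * k ‖p.1 - p.2‖)
      ((volume : Measure E).prod volume) :=
    hf.integrable.aestronglyMeasurable.comp_snd.mul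
      (hk.measurable.comp (by fun_prop)).aestronglyMeasurable
  exact this.integral_prod_right'

lemma pot_le (hf : IsDensity f) (hk : IsKernel E k) (hC : ∀ t, k t ≤ C) (x : E) :
    pot k f x ≤ C * ∫ y, f y := by
  unfold pot
  rw [mul_comm, ← integral_mul_const]
  exact integral_mono (hf.integrable_mul_kernel hk x) (hf.integrable.mul_const C)
    fun y => mul_le_mul_of_nonneg_left (hC _) (hf.nonneg y)

lemma energy_le_of_bounded (hf : IsDensity f) (hk : IsKernel E k) (hC : ∀ t, k t ≤ C) :
    energy k f f ≤ C * (∫ y, f y) * ∫ y, f y := by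
  rw [energy_eq_integral_pot hf hf hk, mul_comm, ← integral_mul_const]
  exact integral_mono (hf.integrable_mul_pot hf hk) (hf.integrable.mul_const _)
    fun y => mul_le_mul_of_nonneg_left (pot_le hf hk hC y) (hf.nonneg y)

/-- The densities of mass `m` supported in the ball of radius `R`. -/
def densities (E : Type*) [NormedAddCommGroup E] [InnerProductSpace ℝ E] [FiniteDimensional ℝ E]
    [MeasurableSpace E] [BorelSpace E] (R m : ℝ) : Set (E → ℝ) :=
  {f | IsDensity f ∧ (∀ x, x ∉ ball (0 : E) R → f x = 0) ∧ ∫ x, f x = m}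

lemma polarize_mem_densities {S : Mirror E} (hS : 0 < S.side 0) (hf : f ∈ densities E R m) :
    S.polarize f ∈ densities E R m := by
  obtain ⟨h1, h2, h3⟩ := hf
  refine ⟨h1.polarize S, fun x hx => ?_, by rw [integral_polarize h1, h3]⟩
  unfold Mirror.polarize
  split_ifs with h0
  · have h4 := (S.norm_sub_le_iff 0 x).2 (mul_nonneg hS.le h0)
    rw [zero_sub, zero_sub, norm_neg, norm_neg] at h4
    have h5 : S.refl x ∉ ball (0 : E) R := by
      simp only [mem_ball_zero_iff, not_lt] at hx ⊢
      exact hx.trans h4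
    rw [h2 x hx, h2 _ h5, max_self]
  · rw [h2 x hx, min_eq_left (h1.nonneg _)]

lemma tendsto_energy {f : ℕ → E → ℝ} {g : E → ℝ} (hk : IsKernel E k) (hC : ∀ t, k t ≤ C)
    (hf : ∀ n, f n ∈ densities E R m) (hg : IsDensity g)
    (hlim : ∀ h : E → ℝ, AEStronglyMeasurable h → (∃ C, ∀ x, |h x| ≤ C) →
      Tendsto (fun n => ∫ x, f n x * h x) atTop (𝓝 (∫ x, g x * h x))) :
    (∀ x, Tendsto (fun n => pot k (f n) x) atTop (𝓝 (pot k g x))) ∧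
      Tendsto (fun n => energy k (f n) (f n)) atTop (𝓝 (energy k g g)) := by
  have hpot : ∀ x, Tendsto (fun n => pot k (f n) x) atTop (𝓝 (pot k g x)) := fun x =>
    hlim _ (hk.measurable.comp (by fun_prop)).aestronglyMeasurable
      ⟨C, fun y => by rw [abs_of_nonneg (hk.nonneg _)]; exact hC _⟩
  refine ⟨hpot, ?_⟩
  have hle : ∀ n x, pot k (f n) x ≤ C * m := fun n x => by
    rw [← (hf n).2.2]; exact pot_le (hf n).1 hk hC x
  have hgle : ∀ x, pot k g x ≤ C * m := fun x => le_of_tendsto' (hpot x) fun n => hle n x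
  have hpn : ∀ n x, 0 ≤ pot k (f n) x := fun n x => hk.pot_nonneg (hf n).1 x
  have hgn : ∀ x, 0 ≤ pot k g x := fun x => hk.pot_nonneg hg x
  have h1 : Tendsto (fun n => ∫ x, f n x * pot k g x) atTop (𝓝 (energy k g g)) := by
    rw [energy_eq_integral_pot hg hg hk]
    exact hlim _ (aestronglyMeasurable_pot hg hk)
      ⟨C * m, fun x => by rw [abs_of_nonneg (hgn x)]; exact hgle x⟩
  have h2 : Tendsto (fun n => ∫ x, f n x * (pot k (f n) x - pot k g x)) atTop (𝓝 0) := by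
    rw [← integral_zero E ℝ]
    refine tendsto_integral_of_dominated_convergence
      (fun x => (ball (0 : E) R).indicator (fun _ => (1 : ℝ)) x * (C * m))
      (fun n => (hf n).1.integrable.aestronglyMeasurable.mul
        ((aestronglyMeasurable_pot (hf n).1 hk).sub (aestronglyMeasurable_pot hg hk)))
      ((isDensity_ball _ _).integrable.mul_const _)
      (fun n => ae_of_all _ fun x => ?_) (ae_of_all _ fun x => ?_)
    · rw [norm_mul]
      have h3 : ‖pot k (f n) x - pot k g x‖ ≤ C * m := by
        rw [Real.norm_eq_abs, abs_le]
        constructor <;> linarith [hle n x, hgle x, hpn n x, hgn x]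
      refine mul_le_mul ?_ h3 (norm_nonneg _) (indicator_nonneg (fun _ _ => zero_le_one) _)
      by_cases hx : x ∈ ball (0 : E) R
      · rw [indicator_of_mem hx, Real.norm_of_nonneg ((hf n).1.nonneg x)]
        exact (hf n).1.le_one x
      · rw [indicator_of_notMem hx, (hf n).2.1 x hx, norm_zero]
    · have h4 : Tendsto (fun n => pot k (f n) x - pot k g x) atTop (𝓝 0) := by
        simpa using (hpot x).sub_const (pot k g x)
      refine squeeze_zero_norm (fun n => ?_) (by simpa using h4.norm)
      rw [norm_mul, Real.norm_of_nonneg ((hf n).1.nonneg x)]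
      exact mul_le_of_le_one_left (norm_nonneg _) ((hf n).1.le_one x)
  have h3 := h2.add h1
  rw [zero_add] at h3
  refine h3.congr fun n => ?_
  have i1 := (hf n).1.integrable_mul_pot (hf n).1 hk
  have i2 := (hf n).1.integrable_mul_pot hg hk
  simp only [mul_sub]
  rw [integral_sub i1 i2, energy_eq_integral_pot (hf n).1 (hf n).1 hk]
  ring

lemma exists_maximizer {w : ℝ → ℝ} {C' : ℝ} (hk : IsKernel E k) (hC : ∀ t, k t ≤ C)
    (hw : IsKernel E w) (hC' : ∀ t, w t ≤ C') (hε : 0 ≤ ε) (hne : (densities E R m).Nonempty) :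
    ∃ f ∈ densities E R m, ∀ g ∈ densities E R m,
      energy k g g + ε * pot w g 0 ≤ energy k f f + ε * pot w f 0 := by
  set J : (E → ℝ) → ℝ := fun f => energy k f f + ε * pot w f 0
  have hbdd : BddAbove (J '' densities E R m) := by
    refine ⟨C * m * m + ε * (C' * m), ?_⟩
    rintro _ ⟨f, ⟨hf, -, hm⟩, rfl⟩
    have h1 := energy_le_of_bounded hf hk hC
    have h2 := pot_le hf hw hC' 0
    rw [hm] at h1 h2
    exact add_le_add h1 (mul_le_mul_of_nonneg_left h2 hε)
  obtain ⟨u, -, hu, hmem⟩ := exists_seq_tendsto_sSup (hne.image J) hbdd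
  choose f hf hfu using hmem
  obtain ⟨g, hg, hgs, φ, hφ, hlim⟩ := exists_weak_limit (fun n => (hf n).1) fun n => (hf n).2.1
  have hgm : ∫ x, g x = m := by
    have h1 := hlim (fun _ => 1) aestronglyMeasurable_const ⟨1, fun _ => by simp⟩
    simp only [mul_one, (hf _).2.2] at h1
    exact (tendsto_nhds_unique h1 tendsto_const_nhds)
  have h1 := (tendsto_energy hk hC (fun n => hf (φ n)) hg hlim).2
  have h2 := (tendsto_energy hw hC' (fun n => hf (φ n)) hg hlim).1 0
  have h3 : Tendsto (fun n => J (f (φ n))) atTop (𝓝 (J g)) := h1.add (h2.const_mul ε)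
  have h4 : J g = sSup (J '' densities E R m) := by
    refine tendsto_nhds_unique h3 ?_
    simp only [hfu]
    exact hu.comp hφ.tendsto_atTop
  exact ⟨g, ⟨hg, hgs, hgm⟩, fun h hh => (le_csSup hbdd (mem_image_of_mem J hh)).trans_eq h4.symm⟩

/-- The profile of a bounded, strictly decreasing and continuous kernel. -/
noncomputable def weight (t : ℝ) : ℝ := (1 + t ^ 2)⁻¹

lemma continuous_weight : Continuous weight :=
  (by fun_prop : Continuous fun t : ℝ => 1 + t ^ 2).inv₀ fun t => by positivity

lemma weight_pos (t : ℝ) : 0 < weight t := by unfold weight; positivity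

lemma weight_le_one (t : ℝ) : weight t ≤ 1 := inv_le_one_of_one_le₀ (by nlinarith [sq_nonneg t])

lemma strictAntiOn_weight : StrictAntiOn weight (Ioi 0) := fun s hs t _ hst => by
  have hs' : 0 < s := hs
  exact inv_strictAnti₀ (by positivity) (by gcongr)

lemma integrableOn_ball_of_bounded {k : ℝ → ℝ} (hm : Measurable k) (h0 : ∀ t, 0 ≤ k t)
    (hC : ∀ t, k t ≤ C) : IntegrableOn (fun z : E => k ‖z‖) (ball 0 1) :=
  Measure.integrableOn_of_bounded (M := C) measure_ball_lt_top.ne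
    (hm.comp measurable_norm).aestronglyMeasurable
    (ae_of_all _ fun z => by rw [Real.norm_of_nonneg (h0 _)]; exact hC _)

lemma isKernel_weight : IsKernel E weight where
  measurable := continuous_weight.measurable
  nonneg t := (weight_pos t).le
  antitoneOn := strictAntiOn_weight.antitoneOn
  integrableOn := integrableOn_ball_of_bounded continuous_weight.measurable
    (fun t => (weight_pos t).le) weight_le_one

lemma energy_le_ball_of_bounded [Nontrivial E] (hk : IsKernel E k) (hC : ∀ t, k t ≤ C)
    (hr : 0 ≤ r) (hf : f ∈ densities E R (volume.real (ball (0 : E) r))) :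
    energy k f f ≤
      energy k ((ball (0 : E) r).indicator fun _ => 1) ((ball (0 : E) r).indicator fun _ => 1) := by
  set m := volume.real (ball (0 : E) r)
  have hm0 : 0 ≤ m := measureReal_nonneg
  refine le_of_forall_pos_le_add fun δ hδ => ?_
  set ε := δ / (m + 1)
  have hε : 0 < ε := by positivity
  have hεm : ε * m ≤ δ := by
    rw [div_mul_eq_mul_div, div_le_iff₀ (by positivity)]
    nlinarith
  obtain ⟨g, hg, hmax⟩ := exists_maximizer hk hC (isKernel_weight (E := E)) weight_le_one hε.le
    ⟨f, hf⟩
  have hS : ∀ S : Mirror E, 0 < S.side 0 → ∀ᵐ y, 0 ≤ S.antisymm g y * S.side y := fun S hS => by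
    refine (S.pot_polarize hg.1 isKernel_weight strictAntiOn_weight hS).2 ?_
    have h1 := hmax _ (polarize_mem_densities hS hg)
    have h2 := S.energy_le_polarize hg.1 hk
    exact le_of_mul_le_mul_left (by linarith) hε
  have h3 := (energy_le_ball_of_radial hg.1 hk hr hg.2.2 (pot_le_pot_of_mirrors hg.1 hk hS)).1
  have h4 := pot_le hg.1 isKernel_weight weight_le_one 0
  rw [hg.2.2, one_mul] at h4
  have h5 := hmax f hf
  have h6 := mul_nonneg hε.le (isKernel_weight.pot_nonneg hf.1 0)
  have h7 := mul_le_mul_of_nonneg_left h4 hε.le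
  linarith

end BoundedKernel

section Rearrangement

variable {E : Type*} [NormedAddCommGroup E] [InnerProductSpace ℝ E] [FiniteDimensional ℝ E]
  [MeasurableSpace E] [BorelSpace E] [Nontrivial E] {k : ℝ → ℝ} {f : E → ℝ} {r : ℝ}

lemma volume_real_ball (c : E) (hr : 0 ≤ r) :
    volume.real (ball c r) = r ^ Module.finrank ℝ E * volume.real (ball (0 : E) 1) := by
  rw [measureReal_def, Measure.addHaar_ball _ c hr, ENNReal.toReal_mul,
    ENNReal.toReal_ofReal (by positivity), measureReal_def]

lemma exists_ball_of_mass {m : ℝ} (hm : 0 ≤ m) (hmr : m ≤ volume.real (ball (0 : E) r))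
    (hr : 0 ≤ r) : ∃ ρ, 0 ≤ ρ ∧ ρ ≤ r ∧ volume.real (ball (0 : E) ρ) = m := by
  have hω : 0 < volume.real (ball (0 : E) 1) :=
    ENNReal.toReal_pos (measure_ball_pos _ _ one_pos).ne' measure_ball_lt_top.ne
  have hcont : ContinuousOn (fun ρ : ℝ => ρ ^ Module.finrank ℝ E * volume.real (ball (0 : E) 1))
      (Icc 0 r) := by fun_prop
  have h0 : (0 : ℝ) ^ Module.finrank ℝ E = 0 := zero_pow Module.finrank_pos.ne'
  obtain ⟨ρ, hρ, h⟩ := intermediate_value_Icc hr hcont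
    (show m ∈ Icc _ _ from ⟨by simpa [h0] using hm, by rwa [← volume_real_ball 0 hr]⟩)
  exact ⟨ρ, hρ.1, hρ.2, by rw [volume_real_ball 0 hρ.1]; exact h⟩

omit [Nontrivial E] in
lemma energy_mono {k₁ k₂ : ℝ → ℝ} {f₁ f₂ : E → ℝ} (hk₁ : IsKernel E k₁) (hk₂ : IsKernel E k₂)
    (hk : ∀ t, k₁ t ≤ k₂ t) (hf₁ : IsDensity f₁) (hf₂ : IsDensity f₂) (hf : ∀ x, f₁ x ≤ f₂ x) :
    energy k₁ f₁ f₁ ≤ energy k₂ f₂ f₂ :=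
  integral_mono (hf₁.integrable_energy hf₁ hk₁) (hf₂.integrable_energy hf₂ hk₂) fun _ =>
    mul_le_mul (mul_le_mul (hf _) (hf _) (hf₁.nonneg _) (hf₂.nonneg _)) (hk _) (hk₁.nonneg _)
      (mul_nonneg (hf₂.nonneg _) (hf₂.nonneg _))

omit [Nontrivial E] in
lemma IsKernel.truncate (hk : IsKernel E k) {C : ℝ} (hC : 0 ≤ C) :
    IsKernel E fun t => min (k t) C where
  measurable := hk.measurable.min measurable_const
  nonneg t := le_min (hk.nonneg t) hC
  antitoneOn _ hs _ ht hst := min_le_min_right C (hk.antitoneOn hs ht hst)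
  integrableOn := integrableOn_ball_of_bounded (hk.measurable.min measurable_const)
    (fun t => le_min (hk.nonneg t) hC) fun _ => min_le_right _ _

omit [Nontrivial E] in
lemma IsDensity.indicator_ball (hf : IsDensity f) (R : ℝ) :
    IsDensity ((ball (0 : E) R).indicator f) :=
  ⟨hf.integrable.indicator measurableSet_ball, indicator_nonneg fun x _ => hf.nonneg x,
    fun x => indicator_apply_le' (fun _ => hf.le_one x) fun _ => zero_le_one⟩

/-- Among all densities of a given mass, the ball maximizes the energy. -/
lemma energy_le_ball (hk : IsKernel E k) (hf : IsDensity f) (hr : 0 ≤ r)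
    (hm : ∫ x, f x = volume.real (ball (0 : E) r)) :
    energy k f f ≤
      energy k ((ball (0 : E) r).indicator fun _ => 1) ((ball (0 : E) r).indicator fun _ => 1) := by
  let K : ℕ → ℝ → ℝ := fun n t => min (k t) n
  let F : ℕ → E → ℝ := fun n => (ball (0 : E) n).indicator f
  have hK : ∀ n, IsKernel E (K n) := fun n => hk.truncate n.cast_nonneg
  have hF : ∀ n, IsDensity (F n) := fun n => hf.indicator_ball n
  have hFf : ∀ n x, F n x ≤ f x := fun n x => indicator_le_self' (fun x _ => hf.nonneg x) x
  have hle : ∀ n, energy (K n) (F n) (F n) ≤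
      energy k ((ball (0 : E) r).indicator fun _ => 1) ((ball (0 : E) r).indicator fun _ => 1) := by
    intro n
    obtain ⟨ρ, hρ, hρr, hvol⟩ := exists_ball_of_mass (E := E) (m := ∫ x, F n x)
      (integral_nonneg (hF n).nonneg)
      (hm ▸ integral_mono (hF n).integrable hf.integrable (hFf n)) hr
    refine (energy_le_ball_of_bounded (hK n) (fun t => min_le_right _ _) hρ
      ⟨hF n, fun x hx => indicator_of_notMem hx f, hvol.symm⟩).trans ?_
    exact energy_mono (hK n) hk (fun t => min_le_left _ _) (isDensity_ball _ _) (isDensity_ball _ _)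
      fun x => indicator_le_indicator_of_subset (ball_subset_ball hρr) (fun _ => zero_le_one) x
  refine le_of_tendsto' (x := atTop) (f := fun n => energy (K n) (F n) (F n)) ?_ hle
  refine tendsto_integral_of_dominated_convergence
    (fun p : E × E => f p.1 * f p.2 * k ‖p.1 - p.2‖)
    (fun n => ((hF n).integrable_energy (hF n) (hK n)).aestronglyMeasurable)
    (hf.integrable_energy hf hk) (fun n => ae_of_all _ fun p => ?_) (ae_of_all _ fun p => ?_)
  · rw [Real.norm_of_nonneg (mul_nonneg (mul_nonneg ((hF n).nonneg _) ((hF n).nonneg _))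
      ((hK n).nonneg _))]
    exact mul_le_mul (mul_le_mul (hFf n _) (hFf n _) ((hF n).nonneg _) (hf.nonneg _))
      (min_le_left _ _) ((hK n).nonneg _) (mul_nonneg (hf.nonneg _) (hf.nonneg _))
  · have hFlim : ∀ x, Tendsto (fun n => F n x) atTop (𝓝 (f x)) := fun x => by
      refine tendsto_const_nhds.congr' ?_
      obtain ⟨n₀, hn₀⟩ := exists_nat_gt ‖x‖
      filter_upwards [eventually_ge_atTop n₀] with n hn
      refine (indicator_of_mem ?_ f).symm
      rw [mem_ball_zero_iff]
      exact hn₀.trans_le (by exact_mod_cast hn)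
    have hKlim : ∀ t, Tendsto (fun n => K n t) atTop (𝓝 (k t)) := fun t => by
      refine tendsto_const_nhds.congr' ?_
      obtain ⟨n₀, hn₀⟩ := exists_nat_gt (k t)
      filter_upwards [eventually_ge_atTop n₀] with n hn
      exact (min_eq_left (hn₀.le.trans (by exact_mod_cast hn))).symm
    exact ((hFlim _).mul (hFlim _)).mul (hKlim _)

end Rearrangement

section Equality

variable {E : Type*} [NormedAddCommGroup E] [InnerProductSpace ℝ E] [FiniteDimensional ℝ E]
  [MeasurableSpace E] [BorelSpace E] {k : ℝ → ℝ} {f : E → ℝ} {r : ℝ}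

/-- The mirror with its two sides exchanged. -/
def Mirror.flip (S : Mirror E) : Mirror E where
  refl := S.refl
  side x := -S.side x
  measurePreserving := S.measurePreserving
  involutive := S.involutive
  norm_refl_sub_refl := S.norm_refl_sub_refl
  side_refl x := by rw [S.side_refl]
  measurable_side := S.measurable_side.neg
  norm_sub_refl_sq x y := by rw [S.norm_sub_refl_sq, neg_mul_neg]

lemma norm_mul_weight_le (hf : IsDensity f) (t : ℝ) (y : E) : ‖f y * weight t‖ ≤ f y := by
  rw [Real.norm_of_nonneg (mul_nonneg (hf.nonneg y) (weight_pos t).le)]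
  exact mul_le_of_le_one_right (hf.nonneg y) (weight_le_one t)

lemma continuous_pot_weight (hf : IsDensity f) : Continuous (pot weight f) :=
  continuous_of_dominated (bound := f)
    (fun x => (hf.integrable_mul_kernel isKernel_weight x).aestronglyMeasurable)
    (fun _ => ae_of_all _ fun y => norm_mul_weight_le hf _ y) hf.integrable
    (ae_of_all _ fun y => continuous_const.mul (continuous_weight.comp (by fun_prop)))

lemma tendsto_weight : Tendsto weight atTop (𝓝 0) :=
  tendsto_inv_atTop_zero.comp
    (tendsto_atTop_add_const_left _ 1 (tendsto_pow_atTop two_ne_zero))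

lemma tendsto_pot_weight (hf : IsDensity f) : Tendsto (pot weight f) (cocompact E) (𝓝 0) := by
  have : (cocompact E).IsCountablyGenerated := by
    rw [← Metric.cobounded_eq_cocompact, ← comap_norm_atTop]
    infer_instance
  rw [← integral_zero E ℝ]
  refine tendsto_integral_filter_of_dominated_convergence f
    (Eventually.of_forall fun x =>
      (hf.integrable_mul_kernel isKernel_weight x).aestronglyMeasurable)
    (Eventually.of_forall fun _ => ae_of_all _ fun y => norm_mul_weight_le hf _ y) hf.integrable
    (ae_of_all _ fun y => ?_)
  have h1 : Tendsto (fun x : E => ‖x - y‖) (cocompact E) atTop :=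
    (tendsto_norm_cocompact_atTop (E := E)).comp
      (Homeomorph.subRight y).isClosedEmbedding.tendsto_cocompact
  simpa using (tendsto_weight.comp h1).const_mul (f y)

lemma pot_weight_pos (hf : IsDensity f) (hpos : 0 < ∫ x, f x) (x : E) : 0 < pot weight f x := by
  unfold pot
  rw [integral_pos_iff_support_of_nonneg hf.nonneg hf.integrable] at hpos
  rw [integral_pos_iff_support_of_nonneg (fun y => mul_nonneg (hf.nonneg y) (weight_pos _).le)
    (hf.integrable_mul_kernel isKernel_weight x)]
  convert hpos using 2
  ext y
  simp [(weight_pos _).ne']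

lemma isCompact_superlevel (hf : IsDensity f) {a : ℝ} (ha : 0 < a) :
    IsCompact {x | a ≤ pot weight f x} := by
  obtain ⟨s, hs, hsub⟩ := mem_cocompact.1 ((tendsto_pot_weight hf).eventually (gt_mem_nhds ha))
  refine hs.of_isClosed_subset (isClosed_le continuous_const (continuous_pot_weight hf)) ?_
  intro x hx
  by_contra h
  have hlt : pot weight f x < a := hsub h
  have hle : a ≤ pot weight f x := hx
  exact not_lt.2 hle hlt

lemma exists_max_pot_weight (hf : IsDensity f) (hpos : 0 < ∫ x, f x) :
    ∃ c, ∀ x, pot weight f x ≤ pot weight f c :=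
  (continuous_pot_weight hf).exists_forall_ge' 0
    (((tendsto_pot_weight hf).eventually (gt_mem_nhds (pot_weight_pos hf hpos 0))).mono
      fun _ h => h.le)

/-- If the potential of `f` is nonincreasing away from every maximum point, the maximum point is
unique. -/
lemma eq_of_max_pot_weight (hf : IsDensity f) (hpos : 0 < ∫ x, f x)
    (hrad : ∀ c, (∀ x, pot weight f x ≤ pot weight f c) →
      ∀ x y, ‖x - c‖ < ‖y - c‖ → pot weight f y ≤ pot weight f x) {c c' : E}
    (hc : ∀ x, pot weight f x ≤ pot weight f c) (hc' : pot weight f c ≤ pot weight f c') :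
    c' = c := by
  obtain ⟨z, hz, hmax⟩ := (isCompact_superlevel hf (pot_weight_pos hf hpos c)).exists_isMaxOn
    ⟨c, le_refl (pot weight f c)⟩ (f := fun x => ‖x - c‖) (by fun_prop)
  have hz' : ∀ x, pot weight f x ≤ pot weight f z := fun x => (hc x).trans hz
  have h1 : ‖c' - c‖ ≤ ‖z - c‖ := hmax hc'
  have h2 : ‖z - c‖ = 0 := by
    by_contra hne
    have hpos' : 0 < ‖z - c‖ := lt_of_le_of_ne (norm_nonneg _) (Ne.symm hne)
    set w := z + (1 / 2 : ℝ) • (z - c)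
    have hw1 : ‖w - z‖ = 1 / 2 * ‖z - c‖ := by
      rw [add_sub_cancel_left, norm_smul]; norm_num
    have hw2 : ‖w - c‖ = 3 / 2 * ‖z - c‖ := by
      have : w - c = (3 / 2 : ℝ) • (z - c) := by simp only [w]; module
      rw [this, norm_smul]; norm_num
    have h3 : pot weight f c ≤ pot weight f w := hrad z hz' w c (by
      rw [hw1, norm_sub_rev c z]; linarith)
    have h4 : ‖w - c‖ ≤ ‖z - c‖ := hmax h3
    linarith
  rw [h2] at h1
  exact sub_eq_zero.1 (norm_le_zero_iff.1 h1)

lemma energy_ball_le [Nontrivial E] (hk : IsKernel E k) (hr : 0 ≤ r) (c : E) :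
    energy k ((ball c r).indicator fun _ => 1) ((ball c r).indicator fun _ => 1) ≤
      energy k ((ball (0 : E) r).indicator fun _ => 1) ((ball (0 : E) r).indicator fun _ => 1) :=
  energy_le_ball hk (isDensity_ball c r) hr (by
    rw [integral_ball_indicator, volume_real_ball c hr, volume_real_ball 0 hr])

/-- For a strictly decreasing kernel, only balls maximize the energy at a given mass. -/
lemma ae_eq_ball_of_energy_ge [Nontrivial E] (hk : IsKernel E k) (hk' : StrictAntiOn k (Ioi 0))
    (hf : IsDensity f) (hr : 0 ≤ r) (hm : ∫ x, f x = volume.real (ball (0 : E) r))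
    (hge : energy k ((ball (0 : E) r).indicator fun _ => 1)
      ((ball (0 : E) r).indicator fun _ => 1) ≤ energy k f f) :
    ∃ c : E, f =ᵐ[volume] (ball c r).indicator fun _ => 1 := by
  obtain h0 | hpos := (integral_nonneg hf.nonneg : 0 ≤ ∫ x, f x).eq_or_lt
  · refine ⟨0, ((integral_eq_zero_iff_of_nonneg hf.nonneg hf.integrable).1 h0.symm).trans
      ((integral_eq_zero_iff_of_nonneg (isDensity_ball _ _).nonneg
        (isDensity_ball _ _).integrable).1 ?_).symm⟩
    rw [integral_ball_indicator, ← hm, ← h0]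
  have hmirror : ∀ c, (∀ x, pot weight f x ≤ pot weight f c) → ∀ S : Mirror E, 0 < S.side c →
      ∀ᵐ y, 0 ≤ S.antisymm f y * S.side y := by
    intro c hc S hS
    have h1 : energy k (S.polarize f) (S.polarize f) ≤ energy k f f :=
      (energy_le_ball hk (hf.polarize S) hr (by rw [integral_polarize hf, hm])).trans hge
    obtain h2 | h2 := S.antisymm_sign_of_energy_eq hf hk hk' h1
    · exact h2
    · have h3 : ∀ᵐ y, 0 ≤ S.flip.antisymm f y * S.flip.side y := by
        filter_upwards [h2] with y hy
        change 0 ≤ S.antisymm f y * -S.side y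
        linarith
      have h4 : 0 < S.flip.side (S.refl c) := by
        change 0 < -S.side (S.refl c)
        rwa [S.side_refl, neg_neg]
      have h5 := S.flip.antisymm_eq_zero_of_pot_eq hf isKernel_weight strictAntiOn_weight h4 h3
        (by change _ ≤ pot weight f (S.refl (S.refl c)); rw [S.involutive]; exact hc _)
      filter_upwards [h5] with y hy
      change S.antisymm f y = 0 at hy
      rw [hy, zero_mul]
  obtain ⟨c, hc⟩ := exists_max_pot_weight hf hpos
  have hrad : ∀ c, (∀ x, pot weight f x ≤ pot weight f c) →
      ∀ x y, ‖x - c‖ < ‖y - c‖ → pot weight f y ≤ pot weight f x := fun c hc =>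
    pot_le_pot_of_mirrors hf isKernel_weight (hmirror c hc)
  refine ⟨c, (energy_le_ball_of_radial hf hk hr ?_
    (pot_le_pot_of_mirrors hf hk (hmirror c hc))).2 ?_ ((energy_ball_le hk hr c).trans hge)⟩
  · rw [hm, volume_real_ball c hr, volume_real_ball 0 hr]
  · intro x y hxy
    by_contra! hle
    obtain ⟨S, rfl, hx⟩ := exists_mirror (a := x) (b := y) (by rintro rfl; exact lt_irrefl _ hxy)
    have hcS := S.side_pos_of_norm_sub_lt hx hxy
    have h0 := S.antisymm_eq_zero_of_pot_eq hf hk hk' hx (hmirror c hc S hcS) hle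
    have h1 := pot_refl_eq_of_antisymm_eq_zero S hf isKernel_weight h0 c
    have h2 := eq_of_max_pot_weight hf hpos hrad hc h1.ge
    have h3 := S.side_refl c
    rw [h2] at h3
    linarith

end Equality

section Power

lemma isKernel_rpow {E : Type*} [NormedAddCommGroup E] [InnerProductSpace ℝ E]
    [FiniteDimensional ℝ E] [MeasurableSpace E] [BorelSpace E] [Nontrivial E] {s : ℝ}
    (hs : s ≤ 0) (hs' : -(Module.finrank ℝ E : ℝ) < s) : IsKernel E fun t => |t| ^ s where
  measurable := by fun_prop
  nonneg t := by positivity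
  antitoneOn t ht u hu htu := by
    rw [mem_Ioi] at ht hu
    simp only [abs_of_pos ht, abs_of_pos hu]
    exact Real.rpow_le_rpow_of_nonpos ht htu hs
  integrableOn := by
    rw [integrableOn_fun_norm_addHaar volume (f := fun t => |t| ^ s)]
    refine IntegrableOn.congr_fun ((intervalIntegral.integrableOn_Ioo_rpow_iff one_pos
      (s := Module.finrank ℝ E - 1 + s)).2 (by linarith)) (fun t ht => ?_) measurableSet_Ioo
    have h1 : (1 : ℕ) ≤ Module.finrank ℝ E := Module.finrank_pos
    simp only [smul_eq_mul, abs_of_pos ht.1]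
    rw [Real.rpow_add ht.1, ← Real.rpow_natCast, Nat.cast_sub h1, Nat.cast_one]

lemma strictAntiOn_rpow_abs {s : ℝ} (hs : s < 0) : StrictAntiOn (fun t : ℝ => |t| ^ s) (Ioi 0) := by
  intro t ht u hu htu
  rw [mem_Ioi] at ht hu
  simp only [abs_of_pos ht, abs_of_pos hu]
  exact Real.rpow_lt_rpow_of_neg ht htu hs

lemma funcEnergy_eq_energy {N : ℕ} {α : ℝ} {f : EuclideanSpace ℝ (Fin N) → ℝ} (hf : IsDensity f)
    (hk : IsKernel (EuclideanSpace ℝ (Fin N)) fun t => |t| ^ (α - N)) :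
    funcEnergy N α f = energy (fun t => |t| ^ (α - N)) f f := by
  unfold energy funcEnergy
  rw [Measure.volume_eq_prod, integral_prod _ (hf.integrable_energy hf hk)]
  simp only [abs_norm, norm_sub_rev]

end Power

end RieszEnergy

theorem func_energy_ball_maximizes (N : ℕ) (hN : 2 ≤ N) (α : ℝ) (hα₁ : 1 < α) (hα₂ : α < N)
    (g : EuclideanSpace ℝ (Fin N) → ℝ) (hg : Integrable g)
    (hg01 : ∀ y, g y ∈ Set.Icc (0 : ℝ) 1) :
    funcEnergy N α g ≤ funcEnergy N α
      ((ball (0 : EuclideanSpace ℝ (Fin N)) (((∫ y, g y) / omegaN N) ^ ((N : ℝ)⁻¹))).indicator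
        fun _ => (1 : ℝ)) ∧
    (funcEnergy N α g = funcEnergy N α
        ((ball (0 : EuclideanSpace ℝ (Fin N)) (((∫ y, g y) / omegaN N) ^ ((N : ℝ)⁻¹))).indicator
          fun _ => (1 : ℝ)) →
      ∃ c : EuclideanSpace ℝ (Fin N),
        g =ᵐ[volume] (ball c (((∫ y, g y) / omegaN N) ^ ((N : ℝ)⁻¹))).indicator
          fun _ => (1 : ℝ)) := by
  have : Nonempty (Fin N) := ⟨⟨0, by omega⟩⟩
  have hf : RieszEnergy.IsDensity g := ⟨hg, fun y => (hg01 y).1, fun y => (hg01 y).2⟩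
  have hk : RieszEnergy.IsKernel (EuclideanSpace ℝ (Fin N)) fun t => |t| ^ (α - N) :=
    RieszEnergy.isKernel_rpow (by linarith) (by rw [finrank_euclideanSpace_fin]; linarith)
  have hω : 0 < omegaN N :=
    ENNReal.toReal_pos (measure_ball_pos _ _ one_pos).ne' measure_ball_lt_top.ne
  have hI : 0 ≤ ∫ y, g y := integral_nonneg hf.nonneg
  set r := ((∫ y, g y) / omegaN N) ^ ((N : ℝ)⁻¹)
  have hr : 0 ≤ r := by positivity
  have hm : ∫ y, g y = volume.real (ball (0 : EuclideanSpace ℝ (Fin N)) r) := by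
    rw [RieszEnergy.volume_real_ball 0 hr, finrank_euclideanSpace_fin,
      Real.rpow_inv_natCast_pow (by positivity) (by omega)]
    exact (div_mul_cancel₀ _ hω.ne').symm
  rw [RieszEnergy.funcEnergy_eq_energy hf hk,
    RieszEnergy.funcEnergy_eq_energy (RieszEnergy.isDensity_ball 0 r) hk]
  exact ⟨RieszEnergy.energy_le_ball hk hf hr hm, fun h =>
    RieszEnergy.ae_eq_ball_of_energy_ge hk (RieszEnergy.strictAntiOn_rpow_abs (sub_neg.2 hα₂)) hf hr
      hm h.ge⟩
end

section
/- Let N ≥ 2 and 1 < α < N. Suppose f, θ : ℝ^N → [0,1] are L¹ functions each of which is radially symmetric and nonincreasing as a function of |x|, and let θ̂ = χ_{B(r)} where r = (‖θ‖_{L¹}/ω_N)^{1/N}. Then 𝔈(f, θ̂) ≥ 𝔈(f, θ). Moreover, if in addition f is the characteristic function of a ball centered at the origin, equality holds only if θ̂ = θ almost everywhere. -/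
open MeasureTheory Metric

noncomputable def funcInteraction (N : ℕ) (α : ℝ)
    (f g : EuclideanSpace ℝ (Fin N) → ℝ) : ℝ :=
  ∫ x, ∫ y, f x * g y * ‖y - x‖ ^ (α - (N : ℝ))

/-- `f` is radially symmetric and nonincreasing as a function of `|x|`. -/
def RadialNonincreasing (N : ℕ) (f : EuclideanSpace ℝ (Fin N) → ℝ) : Prop :=
  ∀ x y : EuclideanSpace ℝ (Fin N), ‖x‖ ≤ ‖y‖ → f y ≤ f x

lemma measurable_norm_rpow {E : Type*} [NormedAddCommGroup E] [MeasurableSpace E] [BorelSpace E]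
    (s : ℝ) : Measurable fun z : E => ‖z‖ ^ s :=
  measurable_norm.pow_const s

lemma norm_indicator_compl_ball_norm_rpow_le {E : Type*} [NormedAddCommGroup E] {s : ℝ} (hs : s ≤ 0) (z : E) :
    ‖(ball (0 : E) 1)ᶜ.indicator (fun z => ‖z‖ ^ s) z‖ ≤ 1 := by
  by_cases hz : z ∈ (ball (0 : E) 1)ᶜ
  · rw [Set.indicator_of_mem hz, Real.norm_of_nonneg (by positivity)]
    exact Real.rpow_le_one_of_one_le_of_nonpos (by simpa using hz) hs
  · simp [Set.indicator_of_notMem hz]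

section Kernel

variable {E : Type*} [NormedAddCommGroup E] [InnerProductSpace ℝ E] [FiniteDimensional ℝ E]
  [MeasurableSpace E] [BorelSpace E]

/-- The potential of `f` for the kernel `‖y - x‖ ^ s`. -/
noncomputable def rieszPotential (s : ℝ) (f : E → ℝ) (y : E) : ℝ :=
  ∫ x, f x * ‖y - x‖ ^ s

lemma integrable_indicator_ball_norm_rpow [Nontrivial E] {s : ℝ}
    (hs : -(Module.finrank ℝ E : ℝ) < s) :
    Integrable ((ball (0 : E) 1).indicator fun z => ‖z‖ ^ s) := by
  rw [integrable_indicator_iff measurableSet_ball]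
  refine integrableOn_ball_of_norm_le_rpow (C := 1) (α := -s) Module.finrank_pos (by linarith)
    (ae_of_all _ fun x => ?_) (measurable_norm_rpow s).aestronglyMeasurable
  rw [neg_neg, one_mul, Real.norm_of_nonneg (by positivity)]

lemma integrable_mul_norm_sub_rpow [Nontrivial E] {s : ℝ}
    (hs : -(Module.finrank ℝ E : ℝ) < s) (hs0 : s ≤ 0) {f : E → ℝ} (hf : Integrable f)
    (hf1 : ∀ x, ‖f x‖ ≤ 1) (y : E) : Integrable fun x => f x * ‖y - x‖ ^ s := by
  have h1 : Integrable fun x => f x * (ball (0 : E) 1).indicator (fun z => ‖z‖ ^ s) (y - x) :=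
    ((integrable_indicator_ball_norm_rpow hs).comp_sub_left y).bdd_mul hf.1 (ae_of_all _ hf1)
  have h2 : Integrable fun x => f x * (ball (0 : E) 1)ᶜ.indicator (fun z => ‖z‖ ^ s) (y - x) :=
    hf.mul_bdd (c := 1) (((measurable_norm_rpow s).indicator measurableSet_ball.compl).comp
      (measurable_const.sub measurable_id)).aestronglyMeasurable
      (ae_of_all _ fun x => norm_indicator_compl_ball_norm_rpow_le hs0 _)
  refine (h1.add h2).congr (ae_of_all _ fun x => ?_)
  simp only [Pi.add_apply, ← mul_add]
  rw [Set.indicator_self_add_compl_apply]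

lemma integrable_prod_mul_norm_sub_rpow [Nontrivial E] {s : ℝ}
    (hs : -(Module.finrank ℝ E : ℝ) < s) (hs0 : s ≤ 0) {f g : E → ℝ} (hf : Integrable f)
    (hg : Integrable g) (hg1 : ∀ x, ‖g x‖ ≤ 1) :
    Integrable (fun p : E × E => f p.1 * g p.2 * ‖p.2 - p.1‖ ^ s) (volume.prod volume) := by
  have h1 : Integrable (fun p : E × E =>
      g p.2 * (f p.1 * (ball (0 : E) 1).indicator (fun z => ‖z‖ ^ s) (p.2 - p.1)))
      (volume.prod volume) :=
    (hf.convolution_integrand (ContinuousLinearMap.mul ℝ ℝ)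
      (integrable_indicator_ball_norm_rpow hs)).swap.bdd_mul
      hg.1.comp_snd (ae_of_all _ fun p => hg1 p.2)
  have h2 : Integrable (fun p : E × E =>
      f p.1 * g p.2 * (ball (0 : E) 1)ᶜ.indicator (fun z => ‖z‖ ^ s) (p.2 - p.1))
      (volume.prod volume) :=
    (hf.mul_prod hg).mul_bdd (c := 1)
      (((measurable_norm_rpow s).indicator measurableSet_ball.compl).comp
      (measurable_snd.sub measurable_fst)).aestronglyMeasurable
      (ae_of_all _ fun p => norm_indicator_compl_ball_norm_rpow_le hs0 _)
  refine (h1.add h2).congr (ae_of_all _ fun p => ?_)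
  have := Set.indicator_self_add_compl_apply (ball (0 : E) 1) (fun z => ‖z‖ ^ s) (p.2 - p.1)
  simp only [Pi.add_apply, ← this]
  ring

lemma integral_integral_mul_norm_sub_rpow [Nontrivial E] {s : ℝ}
    (hs : -(Module.finrank ℝ E : ℝ) < s) (hs0 : s ≤ 0) {f g : E → ℝ} (hf : Integrable f)
    (hg : Integrable g) (hg1 : ∀ x, ‖g x‖ ≤ 1) :
    Integrable (fun y => g y * rieszPotential s f y) ∧
      ∫ x, ∫ y, f x * g y * ‖y - x‖ ^ s = ∫ y, g y * rieszPotential s f y := by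
  have h := integrable_prod_mul_norm_sub_rpow hs hs0 hf hg hg1
  have e : ∀ y, ∫ x, f x * g y * ‖y - x‖ ^ s = g y * rieszPotential s f y := fun y => by
    rw [rieszPotential, ← integral_const_mul]
    congr 1 with x
    ring
  constructor
  · exact h.integral_prod_right.congr (ae_of_all _ e)
  · rw [integral_integral_swap h]
    simp only [e]

/-- The reflection across the perpendicular bisector of two distinct points. -/
lemma exists_bisector_reflection {y y' : E} (hne : y ≠ y') (hle : ‖y‖ ≤ ‖y'‖) :
    ∃ σ : E ≃ᵐ E, MeasurePreserving σ ∧ Continuous σ ∧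
      (∀ x, ‖y - σ x‖ = ‖y' - x‖) ∧ (∀ x, ‖y' - σ x‖ = ‖y - x‖) ∧
      (∀ x, ‖y - x‖ ≤ ‖y' - x‖ → ‖x‖ ≤ ‖σ x‖) ∧ (∀ x, ‖y' - x‖ ≤ ‖y - x‖ → ‖σ x‖ ≤ ‖x‖) ∧
      (‖y‖ < ‖y'‖ → ∀ R > 0, ∃ x, ‖x‖ < R ∧ R < ‖σ x‖) := by
  obtain ⟨u, rfl⟩ : ∃ u, y' = y + u := ⟨y' - y, by abel⟩
  have hu : u ≠ 0 := by simpa using hne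
  have hu2 : 0 < ‖u‖ ^ 2 := by positivity
  set k : ℝ := (‖y + u‖ ^ 2 - ‖y‖ ^ 2) / ‖u‖ ^ 2 with hk
  have hk0 : 0 ≤ k := div_nonneg (by nlinarith [norm_nonneg y]) hu2.le
  let L : E ≃ₗᵢ[ℝ] E := (ℝ ∙ u)ᗮ.reflection
  have hL : ∀ x, L x = x - (2 * inner ℝ u x / ‖u‖ ^ 2) • u := fun x => by
    simp only [L]
    rw [Submodule.reflection_orthogonal_apply, Submodule.reflection_singleton_apply]
    simp only [RCLike.ofReal_real_eq_id, id, neg_sub, two_nsmul, ← add_smul]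
    congr 2
    ring
  let σ : E ≃ᵐ E := L.toMeasurableEquiv.trans (MeasurableEquiv.addRight (k • u))
  have hσ : ∀ x, σ x = L x + k • u := fun x => rfl
  have hkin : k * ‖u‖ ^ 2 = ‖u‖ ^ 2 + 2 * inner ℝ y u := by
    rw [hk, div_mul_cancel₀ _ hu2.ne', norm_add_sq_real]; ring
  have hσc : ∀ x, ∃ c : ℝ, σ x = x + c • u ∧ c * ‖u‖ ^ 2 = ‖y + u - x‖ ^ 2 - ‖y - x‖ ^ 2 ∧
      ‖σ x‖ ^ 2 = ‖x‖ ^ 2 + c * (k * ‖u‖ ^ 2) := fun x => by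
    have h1 : σ x = x + (k - 2 * inner ℝ u x / ‖u‖ ^ 2) • u := by
      rw [hσ, hL, sub_smul]; abel
    have h2 : (k - 2 * inner ℝ u x / ‖u‖ ^ 2) * ‖u‖ ^ 2 = k * ‖u‖ ^ 2 - 2 * inner ℝ u x := by
      rw [sub_mul, div_mul_cancel₀ (2 * inner ℝ u x) hu2.ne']
    refine ⟨_, h1, ?_, ?_⟩
    · have e : y + u - x = (y - x) + u := by abel
      rw [h2, hkin, e, norm_add_sq_real, inner_sub_left, real_inner_comm x u]; ring
    · rw [h1, norm_add_sq_real, norm_smul, mul_pow, inner_smul_right, Real.norm_eq_abs, sq_abs,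
        real_inner_comm u x]
      linear_combination (k - 2 * inner ℝ u x / ‖u‖ ^ 2) * h2
  have hσy : σ y = y + u := by
    obtain ⟨c, h1, h2, -⟩ := hσc y
    have : c = 1 := mul_right_cancel₀ hu2.ne' (by rw [h2]; simp)
    rw [h1, this, one_smul]
  have hσy' : σ (y + u) = y := by
    obtain ⟨c, h1, h2, -⟩ := hσc (y + u)
    have : c = -1 := mul_right_cancel₀ hu2.ne' (by rw [h2]; simp)
    rw [h1, this, neg_one_smul, add_neg_cancel_right]
  have hiso : ∀ a b, ‖σ a - σ b‖ = ‖a - b‖ := fun a b => by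
    rw [hσ, hσ, add_sub_add_right_eq_sub, ← map_sub, L.norm_map]
  refine ⟨σ, ?_, ?_, fun x => ?_, fun x => ?_, fun x hx => ?_, fun x hx => ?_, fun hlt R hR => ?_⟩
  · exact (measurePreserving_add_right volume (k • u)).comp L.measurePreserving
  · exact L.continuous.add continuous_const
  · nth_rw 1 [← hσy']
    exact hiso _ _
  · rw [← hσy]
    exact hiso _ _
  · obtain ⟨c, -, h2, h3⟩ := hσc x
    have hc : 0 ≤ c := nonneg_of_mul_nonneg_left
      (by rw [h2]; nlinarith [norm_nonneg (y - x)]) hu2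
    exact le_of_sq_le_sq (by rw [h3]; linarith [show 0 ≤ c * (k * ‖u‖ ^ 2) by positivity])
      (norm_nonneg _)
  · obtain ⟨c, -, h2, h3⟩ := hσc x
    have hc : 0 ≤ -c := nonneg_of_mul_nonneg_left
      (by rw [neg_mul, h2]; nlinarith [norm_nonneg (y + u - x)]) hu2
    exact le_of_sq_le_sq (by rw [h3]; nlinarith [show 0 ≤ -c * (k * ‖u‖ ^ 2) by positivity])
      (norm_nonneg _)
  · have hkpos : 0 < k := div_pos (by nlinarith [norm_nonneg y]) hu2
    have hun : 0 < ‖u‖ := norm_pos_iff.2 hu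
    have hw : 0 < k * ‖u‖ := by positivity
    have ht : 0 ≤ max 0 (R - k * ‖u‖ / 2) := le_max_left _ _
    refine ⟨L.symm ((max 0 (R - k * ‖u‖ / 2) / ‖u‖) • u), ?_, ?_⟩
    · rw [L.symm.norm_map, norm_smul, Real.norm_of_nonneg (by positivity),
        div_mul_cancel₀ _ hun.ne']
      exact max_lt hR (by linarith)
    · rw [hσ, L.apply_symm_apply, ← add_smul, norm_smul, Real.norm_of_nonneg (by positivity),
        add_mul, div_mul_cancel₀ _ hun.ne']
      linarith [le_max_right 0 (R - k * ‖u‖ / 2)]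

lemma rieszPotential_sub_eq [Nontrivial E] {s : ℝ}
    (hs : -(Module.finrank ℝ E : ℝ) < s) (hs0 : s ≤ 0) {f : E → ℝ} (hf : Integrable f)
    (hf1 : ∀ x, ‖f x‖ ≤ 1) {y y' : E} {σ : E ≃ᵐ E} (hσ : MeasurePreserving σ)
    (h1 : ∀ x, ‖y - σ x‖ = ‖y' - x‖) (h2 : ∀ x, ‖y' - σ x‖ = ‖y - x‖) :
    Integrable (fun x => (f x - f (σ x)) * (‖y - x‖ ^ s - ‖y' - x‖ ^ s)) ∧
      2 * (rieszPotential s f y - rieszPotential s f y') =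
        ∫ x, (f x - f (σ x)) * (‖y - x‖ ^ s - ‖y' - x‖ ^ s) := by
  have i1 := integrable_mul_norm_sub_rpow hs hs0 hf hf1 y
  have i2 := integrable_mul_norm_sub_rpow hs hs0 hf hf1 y'
  have hfσ : Integrable fun x => f (σ x) := hσ.integrable_comp_of_integrable hf
  have i3 := integrable_mul_norm_sub_rpow hs hs0 hfσ (fun x => hf1 _) y
  have i4 := integrable_mul_norm_sub_rpow hs hs0 hfσ (fun x => hf1 _) y'
  have e3 : ∫ x, f (σ x) * ‖y - x‖ ^ s = rieszPotential s f y' := by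
    rw [rieszPotential, ← hσ.integral_comp' fun x => f x * ‖y' - x‖ ^ s]
    simp only [h2]
  have e4 : ∫ x, f (σ x) * ‖y' - x‖ ^ s = rieszPotential s f y := by
    rw [rieszPotential, ← hσ.integral_comp' fun x => f x * ‖y - x‖ ^ s]
    simp only [h1]
  have hsplit : (fun x => (f x - f (σ x)) * (‖y - x‖ ^ s - ‖y' - x‖ ^ s)) = fun x =>
      (f x * ‖y - x‖ ^ s - f x * ‖y' - x‖ ^ s) -
        (f (σ x) * ‖y - x‖ ^ s - f (σ x) * ‖y' - x‖ ^ s) := by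
    ext x; ring
  rw [hsplit]
  have i12 : Integrable fun x => f x * ‖y - x‖ ^ s - f x * ‖y' - x‖ ^ s := i1.sub i2
  have i34 : Integrable fun x => f (σ x) * ‖y - x‖ ^ s - f (σ x) * ‖y' - x‖ ^ s := i3.sub i4
  refine ⟨i12.sub i34, ?_⟩
  rw [integral_sub i12 i34, integral_sub i1 i2, integral_sub i3 i4, e3, e4]
  simp only [rieszPotential]
  ring

lemma ae_reflection_integrand_nonneg [Nontrivial E] {s : ℝ} (hs0 : s ≤ 0) {f : E → ℝ}
    (hfrad : ∀ x y : E, ‖x‖ ≤ ‖y‖ → f y ≤ f x) {y y' : E} {σ : E → E}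
    (h3 : ∀ x, ‖y - x‖ ≤ ‖y' - x‖ → ‖x‖ ≤ ‖σ x‖) (h4 : ∀ x, ‖y' - x‖ ≤ ‖y - x‖ → ‖σ x‖ ≤ ‖x‖) :
    0 ≤ᵐ[volume] fun x => (f x - f (σ x)) * (‖y - x‖ ^ s - ‖y' - x‖ ^ s) := by
  filter_upwards [Measure.ae_ne volume y, Measure.ae_ne volume y'] with x hx hx'
  have p : 0 < ‖y - x‖ := norm_pos_iff.2 (sub_ne_zero.2 hx.symm)
  have p' : 0 < ‖y' - x‖ := norm_pos_iff.2 (sub_ne_zero.2 hx'.symm)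
  rcases le_total ‖y - x‖ ‖y' - x‖ with h | h
  · exact mul_nonneg (sub_nonneg.2 (hfrad _ _ (h3 x h)))
      (sub_nonneg.2 (Real.rpow_le_rpow_of_nonpos p h hs0))
  · exact mul_nonneg_of_nonpos_of_nonpos (sub_nonpos.2 (hfrad _ _ (h4 x h)))
      (sub_nonpos.2 (Real.rpow_le_rpow_of_nonpos p' h hs0))

/-- The potential of a radially nonincreasing function is radially nonincreasing. -/
lemma rieszPotential_le_of_norm_le [Nontrivial E] {s : ℝ}
    (hs : -(Module.finrank ℝ E : ℝ) < s) (hs0 : s ≤ 0) {f : E → ℝ} (hf : Integrable f)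
    (hf1 : ∀ x, ‖f x‖ ≤ 1) (hfrad : ∀ x y : E, ‖x‖ ≤ ‖y‖ → f y ≤ f x) {y y' : E}
    (hle : ‖y‖ ≤ ‖y'‖) : rieszPotential s f y' ≤ rieszPotential s f y := by
  rcases eq_or_ne y y' with rfl | hne
  · rfl
  obtain ⟨σ, hσ, -, h1, h2, h3, h4, -⟩ := exists_bisector_reflection hne hle
  have h := (rieszPotential_sub_eq hs hs0 hf hf1 hσ h1 h2).2
  have := integral_nonneg_of_ae (ae_reflection_integrand_nonneg hs0 hfrad h3 h4)
  linarith

/-- The potential of a centered ball is radially strictly decreasing. -/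
lemma rieszPotential_ball_lt_of_norm_lt [Nontrivial E] {s : ℝ}
    (hs : -(Module.finrank ℝ E : ℝ) < s) (hs0 : s < 0) {R : ℝ} (hR : 0 < R) {y y' : E}
    (hlt : ‖y‖ < ‖y'‖) :
    rieszPotential s ((ball (0 : E) R).indicator fun _ => (1 : ℝ)) y' <
      rieszPotential s ((ball (0 : E) R).indicator fun _ => (1 : ℝ)) y := by
  set f : E → ℝ := (ball (0 : E) R).indicator fun _ => (1 : ℝ)
  have hfi : Integrable f := (integrable_indicator_iff measurableSet_ball).2
    (integrableOn_const (measure_ball_lt_top).ne)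
  have hf1 : ∀ x, ‖f x‖ ≤ 1 := fun x => by
    simpa using norm_indicator_le_norm_self (s := ball (0 : E) R) (fun _ => (1 : ℝ)) x
  have hin : ∀ x, ‖x‖ < R → f x = 1 := fun x hx => Set.indicator_of_mem (by simpa using hx) _
  have hout : ∀ x, R ≤ ‖x‖ → f x = 0 := fun x hx => Set.indicator_of_notMem (by simpa using hx) _
  have hfrad : ∀ x z : E, ‖x‖ ≤ ‖z‖ → f z ≤ f x := fun x z hxz => by
    rcases lt_or_ge ‖z‖ R with h | h
    · rw [hin z h, hin x (hxz.trans_lt h)]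
    · rw [hout z h]
      exact Set.indicator_nonneg (fun _ _ => zero_le_one) x
  obtain ⟨σ, hσ, hσc, h1, h2, h3, h4, h5⟩ :=
    exists_bisector_reflection (fun h => hlt.ne (by rw [h])) hlt.le
  obtain ⟨hI, h⟩ := rieszPotential_sub_eq hs hs0.le hfi hf1 hσ h1 h2
  have hnn := ae_reflection_integrand_nonneg hs0.le hfrad h3 h4
  have hpos : 0 < ∫ x, (f x - f (σ x)) * (‖y - x‖ ^ s - ‖y' - x‖ ^ s) := by
    refine (integral_nonneg_of_ae hnn).lt_of_ne' fun h0 => ?_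
    have hae := (integral_eq_zero_iff_of_nonneg_ae hnn hI).1 h0
    have hopen : IsOpen {x : E | ‖x‖ < R ∧ R < ‖σ x‖} :=
      (isOpen_lt continuous_norm continuous_const).inter
        (isOpen_lt continuous_const hσc.norm)
    refine (hopen.measure_pos volume (h5 hlt R hR)).ne' ?_
    refine measure_eq_zero_iff_ae_notMem.2 ?_
    filter_upwards [hae, Measure.ae_ne volume y] with x hx0 hxy hx
    have hd : ‖y - x‖ < ‖y' - x‖ := not_le.1 fun hc => by linarith [h4 x hc, hx.1, hx.2]
    have := Real.rpow_lt_rpow_of_neg (norm_pos_iff.2 (sub_ne_zero.2 hxy.symm)) hd hs0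
    simp only [Pi.zero_apply, hin x hx.1, hout _ hx.2.le] at hx0
    linarith
  linarith

lemma integral_indicator_ball_one [Nontrivial E] {m : ℝ} (hm : 0 ≤ m) :
    ∫ y, (ball (0 : E) ((m / volume.real (ball (0 : E) 1)) ^
      ((Module.finrank ℝ E : ℝ)⁻¹))).indicator (fun _ => (1 : ℝ)) y = m := by
  have hω : 0 < volume.real (ball (0 : E) 1) :=
    ENNReal.toReal_pos (measure_ball_pos _ _ one_pos).ne' measure_ball_lt_top.ne
  have hq : 0 ≤ m / volume.real (ball (0 : E) 1) := by positivity
  rw [integral_indicator_const _ measurableSet_ball, smul_eq_mul, mul_one, measureReal_def,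
    Measure.addHaar_ball _ _ (by positivity), Real.rpow_inv_natCast_pow hq Module.finrank_pos.ne',
    ENNReal.toReal_mul, ENNReal.toReal_ofReal hq, ← measureReal_def, div_mul_cancel₀ _ hω.ne']

/-- The bathtub principle: among functions with values in `[0,1]` and given mass, the centered ball
maximizes the integral against a radially nonincreasing function `v`, uniquely if `v` is strictly
decreasing. -/
lemma integral_mul_le_integral_ball_mul [Nontrivial E] {θ v : E → ℝ} {r : ℝ} (hr : 0 ≤ r)
    (hθ : Integrable θ) (hθ01 : ∀ x, θ x ∈ Set.Icc (0 : ℝ) 1)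
    (hmass : ∫ y, (ball (0 : E) r).indicator (fun _ => (1 : ℝ)) y = ∫ y, θ y)
    (hv : ∀ x y, ‖x‖ ≤ ‖y‖ → v y ≤ v x) (hθv : Integrable fun y => θ y * v y)
    (hbv : Integrable fun y => (ball (0 : E) r).indicator (fun _ => (1 : ℝ)) y * v y) :
    ∫ y, θ y * v y ≤ ∫ y, (ball (0 : E) r).indicator (fun _ => (1 : ℝ)) y * v y ∧
    ((∀ x y, ‖x‖ < ‖y‖ → v y < v x) →
      ∫ y, θ y * v y = ∫ y, (ball (0 : E) r).indicator (fun _ => (1 : ℝ)) y * v y →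
      θ =ᵐ[volume] (ball (0 : E) r).indicator fun _ => (1 : ℝ)) := by
  set b : E → ℝ := (ball (0 : E) r).indicator fun _ => (1 : ℝ)
  have hbi : Integrable b := (integrable_indicator_iff measurableSet_ball).2
    (integrableOn_const (measure_ball_lt_top).ne)
  have hin : ∀ x, ‖x‖ < r → b x = 1 := fun x hx => Set.indicator_of_mem (by simpa using hx) _
  have hout : ∀ x, r ≤ ‖x‖ → b x = 0 := fun x hx => Set.indicator_of_notMem (by simpa using hx) _
  obtain ⟨e, he⟩ := exists_norm_eq E hr
  have hnn : 0 ≤ fun y => (b y - θ y) * (v y - v e) := fun y => by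
    obtain ⟨h0, h1⟩ := hθ01 y
    rcases lt_or_ge ‖y‖ r with h | h
    · exact mul_nonneg (by rw [hin y h]; linarith) (sub_nonneg.2 (hv _ _ (by linarith)))
    · exact mul_nonneg_of_nonpos_of_nonpos (by rw [hout y h]; linarith)
        (sub_nonpos.2 (hv _ _ (by linarith)))
  have hsplit : (fun y => (b y - θ y) * (v y - v e)) =
      fun y => (b y * v y - θ y * v y) - (b y - θ y) * v e := by
    ext y; ring
  have i1 : Integrable fun y => b y * v y - θ y * v y := hbv.sub hθv
  have i2 : Integrable fun y => (b y - θ y) * v e := (hbi.sub hθ).mul_const _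
  have hI : Integrable fun y => (b y - θ y) * (v y - v e) := by
    rw [hsplit]
    exact i1.sub i2
  have hint : ∫ y, (b y - θ y) * (v y - v e) = (∫ y, b y * v y) - ∫ y, θ y * v y := by
    rw [hsplit, integral_sub i1 i2, integral_sub hbv hθv,
      integral_mul_const, integral_sub hbi hθ, hmass, sub_self, zero_mul, sub_zero]
  refine ⟨by linarith [integral_nonneg (μ := volume) hnn], fun hstrict heq => ?_⟩
  have hae := (integral_eq_zero_iff_of_nonneg hnn hI).1 (by rw [hint, heq, sub_self])
  have hsph : ∀ᵐ y : E, y ∉ sphere (0 : E) r :=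
    measure_eq_zero_iff_ae_notMem.1 (Measure.addHaar_sphere volume 0 r)
  filter_upwards [hae, hsph] with y hy hyr
  have hne : v y - v e ≠ 0 := by
    rw [mem_sphere_zero_iff_norm, ← he] at hyr
    rcases lt_or_gt_of_ne hyr with h | h
    · exact (sub_pos.2 (hstrict _ _ h)).ne'
    · exact (sub_neg.2 (hstrict _ _ h)).ne
  exact (sub_eq_zero.1 ((mul_eq_zero.1 hy).resolve_right hne)).symm

end Kernel

theorem interaction_with_ball_rearrangement (N : ℕ) (hN : 2 ≤ N) (α : ℝ) (hα₁ : 1 < α)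
    (hα₂ : α < N) (f θ : EuclideanSpace ℝ (Fin N) → ℝ)
    (hf : Integrable f) (hf01 : ∀ x, f x ∈ Set.Icc (0 : ℝ) 1) (hfrad : RadialNonincreasing N f)
    (hθ : Integrable θ) (hθ01 : ∀ x, θ x ∈ Set.Icc (0 : ℝ) 1)
    (hθrad : RadialNonincreasing N θ) :
    funcInteraction N α f θ ≤ funcInteraction N α f
      ((ball (0 : EuclideanSpace ℝ (Fin N)) (((∫ y, θ y) / omegaN N) ^ ((N : ℝ)⁻¹))).indicator
        fun _ => (1 : ℝ)) ∧
    ((∃ R : ℝ, 0 < R ∧ f = (ball (0 : EuclideanSpace ℝ (Fin N)) R).indicator fun _ => (1 : ℝ)) →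
      funcInteraction N α f θ = funcInteraction N α f
        ((ball (0 : EuclideanSpace ℝ (Fin N)) (((∫ y, θ y) / omegaN N) ^ ((N : ℝ)⁻¹))).indicator
          fun _ => (1 : ℝ)) →
      θ =ᵐ[volume]
        (ball (0 : EuclideanSpace ℝ (Fin N)) (((∫ y, θ y) / omegaN N) ^ ((N : ℝ)⁻¹))).indicator
          fun _ => (1 : ℝ)) := by
  have : Nontrivial (EuclideanSpace ℝ (Fin N)) :=
    Module.nontrivial_of_finrank_pos (R := ℝ) (by rw [finrank_euclideanSpace_fin]; omega)
  have hs : -(Module.finrank ℝ (EuclideanSpace ℝ (Fin N)) : ℝ) < α - N := by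
    rw [finrank_euclideanSpace_fin]; linarith
  have hs0 : α - N < 0 := by linarith
  have norm_le : ∀ {a : ℝ}, a ∈ Set.Icc (0 : ℝ) 1 → ‖a‖ ≤ 1 := fun h => by
    rw [Real.norm_of_nonneg h.1]; exact h.2
  have hmass := integral_indicator_ball_one (E := EuclideanSpace ℝ (Fin N))
    (integral_nonneg (μ := volume) fun y => (hθ01 y).1)
  have hr : 0 ≤ ((∫ y, θ y) / omegaN N) ^ ((N : ℝ)⁻¹) :=
    Real.rpow_nonneg (div_nonneg (integral_nonneg fun y => (hθ01 y).1) ENNReal.toReal_nonneg) _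
  rw [finrank_euclideanSpace_fin, measureReal_def, ← omegaN] at hmass
  generalize ((∫ y, θ y) / omegaN N) ^ ((N : ℝ)⁻¹) = r at hmass hr ⊢
  have hbi : Integrable ((ball (0 : EuclideanSpace ℝ (Fin N)) r).indicator fun _ => (1 : ℝ)) :=
    (integrable_indicator_iff measurableSet_ball).2 (integrableOn_const measure_ball_lt_top.ne)
  obtain ⟨hθv, eθ⟩ := integral_integral_mul_norm_sub_rpow hs hs0.le hf hθ
    fun x => norm_le (hθ01 x)
  obtain ⟨hbv, eb⟩ := integral_integral_mul_norm_sub_rpow hs hs0.le hf hbi fun x => by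
    simpa using norm_indicator_le_norm_self (s := ball (0 : EuclideanSpace ℝ (Fin N)) r)
      (fun _ => (1 : ℝ)) x
  obtain ⟨hle, huniq⟩ := integral_mul_le_integral_ball_mul hr hθ hθ01 hmass
    (fun x y hxy => rieszPotential_le_of_norm_le hs hs0.le hf (fun x => norm_le (hf01 x)) hfrad hxy)
    hθv hbv
  rw [funcInteraction, funcInteraction, eθ, eb]
  refine ⟨hle, ?_⟩
  rintro ⟨R, hR, rfl⟩ heq
  exact huniq (fun x y hxy => rieszPotential_ball_lt_of_norm_lt hs hs0 hR hxy) heq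
end

section
/- Let N ≥ 2 and 1 < α < N. Let f : ℝ^N → [0,1] be a radially symmetric, radially nonincreasing L¹ function, and for ρ > 0 define ζ(ρ) as the average over y ∈ ∂B(ρ) (with respect to (N−1)-dimensional Hausdorff measure) of ∫_{ℝ^N} f(z) |z−y|^{α−N} dz. Then ζ is a nonincreasing function of ρ; if moreover f is the characteristic function of a ball centered at the origin, ζ is strictly decreasing. -/
open MeasureTheory Metric

section Sphere

/-- The map sending a point of a face of the cube to its radial projection on a sphere. -/
noncomputable def faceToSphere {n : ℕ} (ρ : ℝ) (i : Fin (n + 1)) (s : ℝ) (w : Fin n → ℝ) :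
    EuclideanSpace ℝ (Fin (n + 1)) :=
  (ρ / ‖(WithLp.toLp 2 (i.insertNth s w : Fin (n + 1) → ℝ) : EuclideanSpace ℝ (Fin (n + 1)))‖) •
    WithLp.toLp 2 (i.insertNth s w : Fin (n + 1) → ℝ)

lemma contDiff_faceToSphere {n : ℕ} (ρ : ℝ) (i : Fin (n + 1)) {s : ℝ} (hs : s ≠ 0) :
    ContDiff ℝ 1 (faceToSphere ρ i s) := by
  have h : ContDiff ℝ 1 fun w : Fin n → ℝ ↦
      (WithLp.toLp 2 (i.insertNth s w : Fin (n + 1) → ℝ) : EuclideanSpace ℝ (Fin (n + 1))) := by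
    rw [contDiff_piLp]
    intro k
    induction k using i.succAboveCases with
    | x => simpa using contDiff_const
    | p k => simpa using contDiff_apply ℝ ℝ k
  have h0 (w : Fin n → ℝ) :
      (WithLp.toLp 2 (i.insertNth s w : Fin (n + 1) → ℝ) : EuclideanSpace ℝ (Fin (n + 1))) ≠ 0 := by
    intro hw
    have := congrArg (fun x : EuclideanSpace ℝ (Fin (n + 1)) ↦ x i) hw
    simp [hs] at this
  exact (contDiff_const.div (h.norm ℝ h0) fun w ↦ norm_ne_zero_iff.2 (h0 w)).smul h

lemma sphere_subset_iUnion_faceToSphere {n : ℕ} {ρ : ℝ} (hρ : 0 < ρ) :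
    sphere (0 : EuclideanSpace ℝ (Fin (n + 1))) ρ ⊆
      ⋃ i, (faceToSphere ρ i 1 '' closedBall 0 1 ∪ faceToSphere ρ i (-1) '' closedBall 0 1) := by
  intro x hx
  rw [mem_sphere_zero_iff_norm] at hx
  obtain ⟨i, hi⟩ := Finite.exists_max fun k ↦ |x k|
  have hm : 0 < |x i| := by
    by_contra! h
    have : x = 0 := by
      ext k
      exact abs_nonpos_iff.1 ((hi k).trans h)
    simp [this] at hx
    exact hρ.ne hx
  set w : Fin n → ℝ := fun j ↦ |x i|⁻¹ * x (i.succAbove j)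
  have hw : w ∈ closedBall (0 : Fin n → ℝ) 1 := by
    rw [mem_closedBall_zero_iff, pi_norm_le_iff_of_nonneg zero_le_one]
    intro j
    rw [Real.norm_eq_abs, abs_mul, abs_inv, abs_abs, inv_mul_le_iff₀ hm, mul_one]
    exact hi _
  have key : faceToSphere ρ i (|x i|⁻¹ * x i) w = x := by
    have hv : (WithLp.toLp 2 (i.insertNth (|x i|⁻¹ * x i) w : Fin (n + 1) → ℝ) :
        EuclideanSpace ℝ (Fin (n + 1))) = |x i|⁻¹ • x := by
      ext k
      induction k using i.succAboveCases with
      | x => simp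
      | p k => simp [w]
    rw [faceToSphere, hv, norm_smul, hx, smul_smul, norm_inv, Real.norm_eq_abs, abs_abs]
    have : ρ / (|x i|⁻¹ * ρ) * |x i|⁻¹ = 1 := by field_simp
    rw [this, one_smul]
  refine Set.mem_iUnion.2 ⟨i, ?_⟩
  rcases lt_or_gt_of_ne (abs_pos.1 hm) with h | h
  · refine Or.inr ⟨w, hw, ?_⟩
    rwa [abs_of_neg h, inv_neg, neg_mul, inv_mul_cancel₀ h.ne] at key
  · refine Or.inl ⟨w, hw, ?_⟩
    rwa [abs_of_pos h, inv_mul_cancel₀ h.ne'] at key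

lemma hausdorffMeasure_pi_fin (n : ℕ) : (μH[(n : ℝ)] : Measure (Fin n → ℝ)) = volume := by
  simpa using hausdorffMeasure_pi_real (ι := Fin n)

lemma hausdorffMeasure_faceToSphere_lt_top {n : ℕ} (ρ : ℝ) (i : Fin (n + 1)) {s : ℝ}
    (hs : s ≠ 0) : μH[(n : ℝ)] (faceToSphere ρ i s '' closedBall 0 1) < ⊤ := by
  obtain ⟨K, hK⟩ := (contDiff_faceToSphere ρ i hs).contDiffOn.exists_lipschitzOnWith one_ne_zero
    (convex_closedBall (0 : Fin n → ℝ) 1) (isCompact_closedBall _ _)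
  refine (hK.hausdorffMeasure_image_le n.cast_nonneg).trans_lt ?_
  rw [hausdorffMeasure_pi_fin]
  exact ENNReal.mul_lt_top (ENNReal.rpow_lt_top_of_nonneg n.cast_nonneg ENNReal.coe_ne_top)
    (isCompact_closedBall _ _).measure_lt_top

lemma hausdorffMeasure_sphere_lt_top {n : ℕ} {ρ : ℝ} (hρ : 0 < ρ) :
    μH[(n : ℝ)] (sphere (0 : EuclideanSpace ℝ (Fin (n + 1))) ρ) < ⊤ := by
  refine (measure_mono (sphere_subset_iUnion_faceToSphere hρ)).trans_lt
    ((measure_iUnion_fintype_le _ _).trans_lt (ENNReal.sum_lt_top.2 fun i _ ↦ ?_))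
  exact (measure_union_le _ _).trans_lt (ENNReal.add_lt_top.2
    ⟨hausdorffMeasure_faceToSphere_lt_top ρ i one_ne_zero,
      hausdorffMeasure_faceToSphere_lt_top ρ i (neg_ne_zero.2 one_ne_zero)⟩)

lemma hausdorffMeasure_sphere_pos {n : ℕ} {ρ : ℝ} (hρ : 0 < ρ) :
    0 < μH[(n : ℝ)] (sphere (0 : EuclideanSpace ℝ (Fin (n + 1))) ρ) := by
  set p : EuclideanSpace ℝ (Fin (n + 1)) → Fin n → ℝ := fun x j ↦ x j.succ
  have hp : LipschitzWith 1 p := by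
    refine LipschitzWith.of_dist_le_mul fun x y ↦ ?_
    rw [NNReal.coe_one, one_mul, dist_pi_le_iff dist_nonneg]
    intro j
    rw [dist_eq_norm x y]
    exact PiLp.norm_apply_le (x - y) j.succ
  set U : Set (Fin n → ℝ) := {w | ∑ j, w j ^ 2 < ρ ^ 2}
  have hU : IsOpen U := isOpen_lt (by fun_prop) continuous_const
  have hU0 : U.Nonempty := ⟨0, by simp [U]; positivity⟩
  have hsub : U ⊆ p '' sphere 0 ρ := by
    intro w hw
    refine ⟨WithLp.toLp 2 (Fin.cons √(ρ ^ 2 - ∑ j, w j ^ 2) w : Fin (n + 1) → ℝ), ?_, ?_⟩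
    · rw [mem_sphere_zero_iff_norm, EuclideanSpace.norm_eq, Fin.sum_univ_succ]
      simp [Real.sq_sqrt (sub_nonneg.2 (le_of_lt hw)), Real.sqrt_sq hρ.le]
    · ext j
      simp [p]
  have h := (hU.measure_pos volume hU0).trans_le (measure_mono hsub)
  rw [← hausdorffMeasure_pi_fin] at h
  have h' := h.trans_le (hp.hausdorffMeasure_image_le n.cast_nonneg _)
  simpa using h'

end Sphere

section SwapReflection

open scoped RealInnerProductSpace

variable {E : Type*} [NormedAddCommGroup E] [InnerProductSpace ℝ E]

/-- The reflection exchanging `a • e` and `b • e`, where `c = a + b` and `e` is a unit vector. -/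
noncomputable def swapReflection (e : E) (c : ℝ) (z : E) : E :=
  (ℝ ∙ e)ᗮ.reflection z + c • e

lemma continuous_swapReflection (e : E) (c : ℝ) : Continuous (swapReflection e c) := by
  unfold swapReflection
  fun_prop

lemma swapReflection_smul (e : E) (c t : ℝ) : swapReflection e c (t • e) = (c - t) • e := by
  rw [swapReflection, map_smul, Submodule.reflection_orthogonalComplement_singleton_eq_neg]
  module

lemma norm_swapReflection_sub (e : E) (a b : ℝ) (z : E) :
    ‖swapReflection e (a + b) z - a • e‖ = ‖z - b • e‖ := by
  rw [← (ℝ ∙ e)ᗮ.reflection.norm_map (z - b • e), map_sub, map_smul,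
    Submodule.reflection_orthogonalComplement_singleton_eq_neg, swapReflection]
  congr 1
  module

lemma norm_swapReflection_sq {e : E} (he : ‖e‖ = 1) (c : ℝ) (z : E) :
    ‖swapReflection e c z‖ ^ 2 = ‖z‖ ^ 2 + c * (c - 2 * ⟪z, e⟫) := by
  have h := norm_swapReflection_sub e 0 c z
  rw [zero_add, zero_smul, sub_zero] at h
  rw [h, norm_sub_sq_real, norm_smul, he, inner_smul_right, mul_one, Real.norm_eq_abs, sq_abs]
  ring

lemma norm_sub_smul_sq {e : E} (he : ‖e‖ = 1) (t : ℝ) (z : E) :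
    ‖z - t • e‖ ^ 2 = ‖z‖ ^ 2 - 2 * t * ⟪z, e⟫ + t ^ 2 := by
  rw [norm_sub_sq_real, norm_smul, he, inner_smul_right, mul_one, Real.norm_eq_abs, sq_abs]
  ring

lemma measurableEmbedding_swapReflection [MeasurableSpace E] [BorelSpace E]
    (e : E) (c : ℝ) :
    MeasurableEmbedding (swapReflection e c) :=
  (measurableEmbedding_addRight (c • e)).comp
    (ℝ ∙ e)ᗮ.reflection.toHomeomorph.measurableEmbedding

lemma sub_mul_rpow_sub_rpow_nonneg {f : E → ℝ} (hf : ∀ x y : E, ‖x‖ ≤ ‖y‖ → f y ≤ f x) {β : ℝ}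
    (hβ : β ≤ 0) {e : E} (he : ‖e‖ = 1) {a b : ℝ} (ha : 0 < a) (hab : a < b) {z : E}
    (hza : z ≠ a • e) (hzb : z ≠ b • e) :
    0 ≤ (f z - f (swapReflection e (a + b) z)) * (‖z - a • e‖ ^ β - ‖z - b • e‖ ^ β) := by
  have h1 := norm_swapReflection_sq he (a + b) z
  have h2 := norm_sub_smul_sq he a z
  have h3 := norm_sub_smul_sq he b z
  have hpa : 0 < ‖z - a • e‖ := norm_pos_iff.2 (sub_ne_zero.2 hza)
  have hpb : 0 < ‖z - b • e‖ := norm_pos_iff.2 (sub_ne_zero.2 hzb)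
  rcases le_total (2 * ⟪z, e⟫) (a + b) with h | h
  · refine mul_nonneg (sub_nonneg.2 (hf _ _ ?_)) (sub_nonneg.2 ?_)
    · refine le_of_sq_le_sq ?_ (norm_nonneg _)
      nlinarith
    · refine Real.rpow_le_rpow_of_nonpos hpa (le_of_sq_le_sq ?_ (norm_nonneg _)) hβ
      nlinarith
  · refine mul_nonneg_of_nonpos_of_nonpos (sub_nonpos.2 (hf _ _ ?_)) (sub_nonpos.2 ?_)
    · refine le_of_sq_le_sq ?_ (norm_nonneg _)
      nlinarith
    · refine Real.rpow_le_rpow_of_nonpos hpb (le_of_sq_le_sq ?_ (norm_nonneg _)) hβ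
      nlinarith

end SwapReflection

section Potential

open scoped RealInnerProductSpace

variable {E : Type*} [NormedAddCommGroup E] [InnerProductSpace ℝ E] [FiniteDimensional ℝ E]
  [MeasurableSpace E] [BorelSpace E]

lemma integrable_mul_norm_sub_rpow_s12 {f : E → ℝ} (hf : Integrable f)
    (hf01 : ∀ x, f x ∈ Set.Icc (0 : ℝ) 1) (hE : 1 ≤ Module.finrank ℝ E) {β : ℝ}
    (hβ : -(Module.finrank ℝ E : ℝ) < β) (hβ0 : β ≤ 0) (y : E) :
    Integrable fun z ↦ f z * ‖z - y‖ ^ β := by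
  have hm : Measurable fun z : E ↦ ‖z‖ ^ β := by fun_prop
  have hball : IntegrableOn (fun z : E ↦ ‖z‖ ^ β) (ball 0 1) := by
    refine integrableOn_ball_of_norm_le_rpow hE (C := 1) (α := -β) (by linarith)
      (Filter.Eventually.of_forall fun z ↦ ?_) hm.aestronglyMeasurable
    rw [Real.norm_of_nonneg (by positivity), neg_neg, one_mul]
  have hk : Integrable fun z : E ↦ (ball 0 1).indicator (fun z : E ↦ ‖z‖ ^ β) (z - y) :=
    (hball.integrable_indicator measurableSet_ball).comp_sub_right y
  refine (hf.add hk).mono' (hf.aestronglyMeasurable.mul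
    (hm.comp (measurable_id.sub_const y)).aestronglyMeasurable)
    (Filter.Eventually.of_forall fun z ↦ ?_)
  obtain ⟨h0, h1⟩ := hf01 z
  have hn : 0 ≤ ‖z - y‖ ^ β := by positivity
  rw [Real.norm_of_nonneg (by positivity), Pi.add_apply]
  by_cases hz : z - y ∈ ball (0 : E) 1
  · rw [Set.indicator_of_mem hz]
    nlinarith
  · rw [Set.indicator_of_notMem hz, add_zero]
    have : 1 ≤ ‖z - y‖ := by simpa using hz
    exact mul_le_of_le_one_right h0 (Real.rpow_le_one_of_one_le_of_nonpos this hβ0)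

lemma integral_mul_norm_sub_rpow_congr {f : E → ℝ} (hf : ∀ x y, ‖x‖ = ‖y‖ → f x = f y) (β : ℝ)
    {y y' : E} (h : ‖y‖ = ‖y'‖) :
    ∫ z, f z * ‖z - y‖ ^ β = ∫ z, f z * ‖z - y'‖ ^ β := by
  set T := (ℝ ∙ (y - y'))ᗮ.reflection
  have hT : T y = y' := Submodule.reflection_sub h
  rw [← T.measurePreserving.integral_comp T.toHomeomorph.measurableEmbedding
    (fun z ↦ f z * ‖z - y'‖ ^ β)]
  refine integral_congr_ae (Filter.Eventually.of_forall fun z ↦ ?_)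
  simp only
  rw [hf (T z) z (T.norm_map z), ← hT, ← map_sub, T.norm_map]

lemma measurePreserving_swapReflection (e : E) (c : ℝ) :
    MeasurePreserving (swapReflection e c) :=
  (measurePreserving_add_right volume (c • e)).comp (ℝ ∙ e)ᗮ.reflection.measurePreserving

lemma two_mul_integral_sub_integral_eq {f : E → ℝ} {β : ℝ}
    (hint : ∀ y, Integrable fun z ↦ f z * ‖z - y‖ ^ β) (e : E) (a b : ℝ) :
    Integrable (fun z ↦ (f z - f (swapReflection e (a + b) z)) *
      (‖z - a • e‖ ^ β - ‖z - b • e‖ ^ β)) ∧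
    2 * ((∫ z, f z * ‖z - a • e‖ ^ β) - ∫ z, f z * ‖z - b • e‖ ^ β) =
      ∫ z, (f z - f (swapReflection e (a + b) z)) * (‖z - a • e‖ ^ β - ‖z - b • e‖ ^ β) := by
  set σ := swapReflection e (a + b)
  have ha (z : E) : ‖σ z - a • e‖ = ‖z - b • e‖ := norm_swapReflection_sub e a b z
  have hb (z : E) : ‖σ z - b • e‖ = ‖z - a • e‖ := by
    simpa only [add_comm b a] using norm_swapReflection_sub e b a z
  have hmp : MeasurePreserving σ := measurePreserving_swapReflection e (a + b)
  have hme : MeasurableEmbedding σ := measurableEmbedding_swapReflection e (a + b)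
  have hia : Integrable fun z ↦ f (σ z) * ‖z - b • e‖ ^ β := by
    simpa only [Function.comp_def, ha] using (hmp.integrable_comp_emb hme).2 (hint (a • e))
  have hib : Integrable fun z ↦ f (σ z) * ‖z - a • e‖ ^ β := by
    simpa only [Function.comp_def, hb] using (hmp.integrable_comp_emb hme).2 (hint (b • e))
  have ea : ∫ z, f z * ‖z - a • e‖ ^ β = ∫ z, f (σ z) * ‖z - b • e‖ ^ β := by
    simpa only [ha] using (hmp.integral_comp hme fun z ↦ f z * ‖z - a • e‖ ^ β).symm
  have eb : ∫ z, f z * ‖z - b • e‖ ^ β = ∫ z, f (σ z) * ‖z - a • e‖ ^ β := by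
    simpa only [hb] using (hmp.integral_comp hme fun z ↦ f z * ‖z - b • e‖ ^ β).symm
  have hF : (fun z ↦ (f z - f (σ z)) * (‖z - a • e‖ ^ β - ‖z - b • e‖ ^ β)) =
      fun z ↦ (f z * ‖z - a • e‖ ^ β - f z * ‖z - b • e‖ ^ β) +
        (f (σ z) * ‖z - b • e‖ ^ β - f (σ z) * ‖z - a • e‖ ^ β) := by
    ext z
    ring
  have h1 : Integrable fun z ↦ f z * ‖z - a • e‖ ^ β - f z * ‖z - b • e‖ ^ β :=
    (hint _).sub (hint _)
  have h2 : Integrable fun z ↦ f (σ z) * ‖z - b • e‖ ^ β - f (σ z) * ‖z - a • e‖ ^ β :=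
    hia.sub hib
  refine ⟨hF ▸ h1.add h2, ?_⟩
  rw [hF, integral_add h1 h2, integral_sub (hint _) (hint _), integral_sub hia hib, ← ea, ← eb]
  ring

lemma ae_sub_mul_rpow_sub_rpow_nonneg [Nontrivial E] {f : E → ℝ}
    (hf : ∀ x y : E, ‖x‖ ≤ ‖y‖ → f y ≤ f x) {β : ℝ}
    (hβ : β ≤ 0) {e : E} (he : ‖e‖ = 1) {a b : ℝ} (ha : 0 < a) (hab : a < b) :
    ∀ᵐ z, 0 ≤ (f z - f (swapReflection e (a + b) z)) *
      (‖z - a • e‖ ^ β - ‖z - b • e‖ ^ β) := by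
  filter_upwards [Measure.ae_ne volume (a • e), Measure.ae_ne volume (b • e)] with z hza hzb
  exact sub_mul_rpow_sub_rpow_nonneg hf hβ he ha hab hza hzb

lemma integral_mul_norm_sub_rpow_le [Nontrivial E] {f : E → ℝ}
    (hf : ∀ x y : E, ‖x‖ ≤ ‖y‖ → f y ≤ f x) {β : ℝ} (hβ : β ≤ 0)
    (hint : ∀ y, Integrable fun z ↦ f z * ‖z - y‖ ^ β) {e : E} (he : ‖e‖ = 1) {a b : ℝ}
    (ha : 0 < a) (hab : a < b) :
    ∫ z, f z * ‖z - b • e‖ ^ β ≤ ∫ z, f z * ‖z - a • e‖ ^ β := by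
  have h := integral_nonneg_of_ae (ae_sub_mul_rpow_sub_rpow_nonneg hf hβ he ha hab)
  rw [← (two_mul_integral_sub_integral_eq hint e a b).2] at h
  linarith

lemma integral_indicator_ball_mul_norm_sub_rpow_lt [Nontrivial E] {f : E → ℝ} {R : ℝ} (hR : 0 < R)
    (hfR : f = (ball (0 : E) R).indicator fun _ ↦ (1 : ℝ))
    (hf : ∀ x y : E, ‖x‖ ≤ ‖y‖ → f y ≤ f x) {β : ℝ} (hβ : β < 0)
    (hint : ∀ y, Integrable fun z ↦ f z * ‖z - y‖ ^ β) {e : E} (he : ‖e‖ = 1) {a b : ℝ}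
    (ha : 0 < a) (hab : a < b) :
    ∫ z, f z * ‖z - b • e‖ ^ β < ∫ z, f z * ‖z - a • e‖ ^ β := by
  obtain ⟨hi, heq⟩ := two_mul_integral_sub_integral_eq hint e a b
  set U : Set E := {z | ‖z‖ < R} ∩ {z | R < ‖swapReflection e (a + b) z‖}
  have hU : IsOpen U := (isOpen_lt continuous_norm continuous_const).inter
    (isOpen_lt continuous_const (continuous_swapReflection e _).norm)
  have hU0 : U.Nonempty := by
    set m := min R ((a + b) / 2)
    have hm : 0 < m := lt_min hR (by linarith)
    have hm1 : m ≤ R := min_le_left _ _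
    have hm2 : m ≤ (a + b) / 2 := min_le_right _ _
    refine ⟨(-R + m) • e, ?_, ?_⟩
    · rw [Set.mem_ofPred_eq, norm_smul, he, mul_one, Real.norm_eq_abs, abs_lt]
      constructor <;> linarith
    · rw [Set.mem_ofPred_eq, swapReflection_smul, norm_smul, he, mul_one, Real.norm_eq_abs]
      exact lt_of_lt_of_le (by linarith) (le_abs_self _)
  have hpos : 0 < ∫ z, (f z - f (swapReflection e (a + b) z)) *
      (‖z - a • e‖ ^ β - ‖z - b • e‖ ^ β) := by
    rw [integral_pos_iff_support_of_nonneg_ae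
      (ae_sub_mul_rpow_sub_rpow_nonneg hf hβ.le he ha hab) hi]
    refine (hU.measure_pos volume hU0).trans_le (measure_mono_ae ?_)
    filter_upwards [Measure.ae_ne volume (a • e)] with z hza hz
    obtain ⟨hz1, hz2⟩ : ‖z‖ < R ∧ R < ‖swapReflection e (a + b) z‖ := hz
    have hlt : ‖z - a • e‖ < ‖z - b • e‖ := by
      have h1 := norm_swapReflection_sq he (a + b) z
      have h2 := norm_sub_smul_sq he a z
      have h3 := norm_sub_smul_sq he b z
      refine lt_of_pow_lt_pow_left₀ 2 (norm_nonneg _) ?_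
      have h4 : ‖z‖ ^ 2 < ‖swapReflection e (a + b) z‖ ^ 2 :=
        pow_lt_pow_left₀ (hz1.trans hz2) (norm_nonneg _) two_ne_zero
      have h5 : 0 < a + b - 2 * ⟪z, e⟫ := by
        by_contra! h
        nlinarith
      nlinarith
    have hf1 : f z = 1 := by
      rw [hfR, Set.indicator_of_mem (by simpa using hz1)]
    have hf2 : f (swapReflection e (a + b) z) = 0 := by
      rw [hfR, Set.indicator_of_notMem (by simpa using hz2.le)]
    have hK := Real.rpow_lt_rpow_of_neg (norm_pos_iff.2 (sub_ne_zero.2 hza)) hlt hβ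
    change _ * _ ≠ (0 : ℝ)
    rw [hf1, hf2, sub_zero, one_mul]
    exact (sub_pos.2 hK).ne'
  linarith

end Potential

theorem spherical_average_of_potential_antitone (N : ℕ) (hN : 2 ≤ N) (α : ℝ) (hα₁ : 1 < α)
    (hα₂ : α < N) (f : EuclideanSpace ℝ (Fin N) → ℝ) (hf : Integrable f)
    (hf01 : ∀ x, f x ∈ Set.Icc (0 : ℝ) 1) (hfrad : RadialNonincreasing N f)
    (ζ : ℝ → ℝ)
    (hζ : ∀ ρ : ℝ, ζ ρ = ⨍ y in sphere (0 : EuclideanSpace ℝ (Fin N)) ρ,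
      (∫ z, f z * ‖z - y‖ ^ (α - (N : ℝ))) ∂(μH[(N : ℝ) - 1])) :
    AntitoneOn ζ (Set.Ioi 0) ∧
    ((∃ R : ℝ, 0 < R ∧ f = (ball (0 : EuclideanSpace ℝ (Fin N)) R).indicator fun _ => (1 : ℝ)) →
      StrictAntiOn ζ (Set.Ioi 0)) := by
  obtain ⟨n, rfl⟩ : ∃ n, N = n + 1 := ⟨N - 1, by omega⟩
  have hβ : α - ((n + 1 : ℕ) : ℝ) < 0 := by linarith
  have hrank : Module.finrank ℝ (EuclideanSpace ℝ (Fin (n + 1))) = n + 1 := by simp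
  have hint := integrable_mul_norm_sub_rpow_s12 hf hf01 (by omega) (β := α - ((n + 1 : ℕ) : ℝ))
    (by rw [hrank]; linarith) hβ.le
  obtain ⟨e, he⟩ := exists_norm_eq (EuclideanSpace ℝ (Fin (n + 1))) zero_le_one
  have hval (ρ : ℝ) (hρ : 0 < ρ) : ζ ρ = ∫ z, f z * ‖z - ρ • e‖ ^ (α - ((n + 1 : ℕ) : ℝ)) := by
    have hn : ((n + 1 : ℕ) : ℝ) - 1 = n := by push_cast; ring
    rw [hζ, hn, setAverage_congr_fun (g := fun _ ↦
      ∫ z, f z * ‖z - ρ • e‖ ^ (α - ((n + 1 : ℕ) : ℝ))) isClosed_sphere.measurableSet,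
      setAverage_const (hausdorffMeasure_sphere_pos hρ).ne'
        (hausdorffMeasure_sphere_lt_top hρ).ne]
    refine Filter.Eventually.of_forall fun y hy ↦ integral_mul_norm_sub_rpow_congr
      (fun x y h ↦ le_antisymm (hfrad _ _ h.ge) (hfrad _ _ h.le)) _ ?_
    rw [mem_sphere_zero_iff_norm.1 hy, norm_smul, he, mul_one, Real.norm_of_nonneg hρ.le]
  refine ⟨fun a ha b hb hab ↦ ?_, fun ⟨R, hR, hfR⟩ a ha b hb hab ↦ ?_⟩
  · rcases hab.eq_or_lt with rfl | hab
    · exact le_rfl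
    rw [hval a ha, hval b hb]
    exact integral_mul_norm_sub_rpow_le hfrad hβ.le hint he ha hab
  · rw [hval a ha, hval b hb]
    exact integral_indicator_ball_mul_norm_sub_rpow_lt hR hfR hfrad hβ hint he ha hab
end

section
/- Let N ≥ 2 and 1 < α < N. Let f_n : ℝ^N → [0,1] be a sequence of L¹ functions which converges weakly-* in L^∞(ℝ^N) to an L¹ function f : ℝ^N → [0,1], and assume ∫ f = lim_{n→∞} ∫ f_n. Then 𝔉(f) = lim_{n→∞} 𝔉(f_n). -/
open MeasureTheory Metric Filter

section WeakStar

variable {X : Type*} [MeasurableSpace X] {μ : Measure X} {f : ℕ → X → ℝ} {F : X → ℝ}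

/-- If `f n` takes values in `[0, 1]` and converges to `F` when tested against integrable functions,
then it can also be tested against a sequence that converges in `L¹` by domination. -/
lemma tendsto_integral_mul_of_dominated
    (hf : ∀ n, AEStronglyMeasurable (f n) μ) (hf01 : ∀ n x, f n x ∈ Set.Icc (0 : ℝ) 1)
    (hweak : ∀ φ : X → ℝ, Integrable φ μ →
      Tendsto (fun n => ∫ x, f n x * φ x ∂μ) atTop (nhds (∫ x, F x * φ x ∂μ)))
    {g : ℕ → X → ℝ} {G b : X → ℝ} (hb : Integrable b μ)
    (hg : ∀ n, AEStronglyMeasurable (g n) μ) (hgb : ∀ n, ∀ᵐ x ∂μ, ‖g n x‖ ≤ b x)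
    (hgG : ∀ᵐ x ∂μ, Tendsto (fun n => g n x) atTop (nhds (G x))) :
    Tendsto (fun n => ∫ x, f n x * g n x ∂μ) atTop (nhds (∫ x, F x * G x ∂μ)) := by
  have hf1 n x : ‖f n x‖ ≤ 1 := by
    rw [Real.norm_of_nonneg (hf01 n x).1]; exact (hf01 n x).2
  have hGb : ∀ᵐ x ∂μ, ‖G x‖ ≤ b x := by
    filter_upwards [hgG, ae_all_iff.2 hgb] with x hx hxb
    exact le_of_tendsto' hx.norm hxb
  have hGm : AEStronglyMeasurable G μ := aestronglyMeasurable_of_tendsto_ae atTop hg hgG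
  have hGi : Integrable G μ := hb.mono' hGm hGb
  have hgi n : Integrable (g n) μ := hb.mono' (hg n) (hgb n)
  have hdiff : Tendsto (fun n => ∫ x, f n x * (g n x - G x) ∂μ) atTop (nhds (∫ _, (0 : ℝ) ∂μ)) := by
    refine tendsto_integral_of_dominated_convergence (fun x => b x + b x)
      (fun n => (hf n).mul ((hg n).sub hGm)) (hb.add hb) (fun n => ?_) ?_
    · filter_upwards [hgb n, hGb] with x h₁ h₂
      rw [norm_mul]
      calc ‖f n x‖ * ‖g n x - G x‖ ≤ 1 * ‖g n x - G x‖ := by gcongr; exact hf1 n x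
        _ ≤ b x + b x := by rw [one_mul]; exact (norm_sub_le _ _).trans (add_le_add h₁ h₂)
    · filter_upwards [hgG] with x hx
      refine squeeze_zero_norm (fun n => ?_) (tendsto_iff_norm_sub_tendsto_zero.1 hx)
      rw [norm_mul]
      exact mul_le_of_le_one_left (norm_nonneg _) (hf1 n x)
  rw [integral_zero] at hdiff
  have hsum := hdiff.add (hweak G hGi)
  rw [zero_add] at hsum
  refine hsum.congr fun n => ?_
  have hmul {u : X → ℝ} (hu : Integrable u μ) : Integrable (fun x => f n x * u x) μ :=
    hu.bdd_mul (hf n) (.of_forall (hf1 n))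
  simp_rw [mul_sub]
  rw [integral_sub (hmul (hgi n)) (hmul hGi), sub_add_cancel]

/-- If moreover no mass is lost in the limit, then the test functions need only be
uniformly bounded. -/
lemma tendsto_integral_mul_of_bounded [SigmaFinite μ]
    (hf : ∀ n, Integrable (f n) μ) (hf01 : ∀ n x, f n x ∈ Set.Icc (0 : ℝ) 1)
    (hF : Integrable F μ) (hF0 : ∀ x, 0 ≤ F x)
    (hweak : ∀ φ : X → ℝ, Integrable φ μ →
      Tendsto (fun n => ∫ x, f n x * φ x ∂μ) atTop (nhds (∫ x, F x * φ x ∂μ)))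
    (hmass : Tendsto (fun n => ∫ x, f n x ∂μ) atTop (nhds (∫ x, F x ∂μ)))
    {g : ℕ → X → ℝ} {G : X → ℝ} {C : ℝ}
    (hg : ∀ n, AEStronglyMeasurable (g n) μ) (hgC : ∀ n x, ‖g n x‖ ≤ C)
    (hgG : ∀ x, Tendsto (fun n => g n x) atTop (nhds (G x))) :
    Tendsto (fun n => ∫ x, f n x * g n x ∂μ) atTop (nhds (∫ x, F x * G x ∂μ)) := by
  have hGC x : ‖G x‖ ≤ C := le_of_tendsto' (hgG x).norm fun n => hgC n x
  have hGm : AEStronglyMeasurable G μ :=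
    aestronglyMeasurable_of_tendsto_ae atTop hg (.of_forall hgG)
  have tail {u h : X → ℝ} {s : Set X} (hs : MeasurableSet s) (hu : Integrable u μ)
      (hu0 : ∀ x, 0 ≤ u x) (hh : AEStronglyMeasurable h μ) (hhC : ∀ x, ‖h x‖ ≤ C) :
      ‖∫ x, u x * h x ∂μ - ∫ x in s, u x * h x ∂μ‖ ≤
        C * (∫ x, u x ∂μ - ∫ x in s, u x ∂μ) := by
    rw [← setIntegral_compl hs hu, ← setIntegral_compl hs (hu.mul_bdd hh (.of_forall hhC)),
      ← integral_const_mul]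
    refine norm_integral_le_of_norm_le (hu.integrableOn.const_mul C) (.of_forall fun x => ?_)
    rw [norm_mul, Real.norm_of_nonneg (hu0 x), mul_comm]
    exact mul_le_mul_of_nonneg_right (hhC x) (hu0 x)
  have hset (s : Set X) (hs : MeasurableSet s) (hsμ : μ s < ⊤) {h : ℕ → X → ℝ} {H : X → ℝ} {D : ℝ}
      (hh : ∀ n, AEStronglyMeasurable (h n) μ) (hhD : ∀ n x, ‖h n x‖ ≤ D)
      (hhH : ∀ x, Tendsto (fun n => h n x) atTop (nhds (H x))) :
      Tendsto (fun n => ∫ x in s, f n x * h n x ∂μ) atTop (nhds (∫ x in s, F x * H x ∂μ)) := by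
    simp_rw [← integral_indicator hs, Set.indicator_mul_right]
    refine tendsto_integral_mul_of_dominated (fun n => (hf n).1) hf01 hweak
      (b := s.indicator fun _ => D) ((integrable_indicator_iff hs).2 (integrableOn_const hsμ.ne))
      (fun n => (hh n).indicator hs) (fun n => .of_forall fun x => ?_) (.of_forall fun x => ?_)
    · by_cases hx : x ∈ s <;> simp [hx]
      exact hhD n x
    · by_cases hx : x ∈ s <;> simp [hx, hhH]
  have hcover : Tendsto (fun i => 2 * C * (∫ x, F x ∂μ - ∫ x in spanningSets μ i, F x ∂μ)) atTop
      (nhds 0) := by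
    have h := tendsto_setIntegral_of_monotone (μ := μ) (f := F) (measurableSet_spanningSets μ)
      (monotone_spanningSets μ) hF.integrableOn
    rw [iUnion_spanningSets, setIntegral_univ] at h
    simpa using (h.const_sub (∫ x, F x ∂μ)).const_mul (2 * C)
  rw [tendsto_iff_norm_sub_tendsto_zero]
  refine (tendsto_order.2 ⟨fun a ha => .of_forall fun n => ha.trans_le (norm_nonneg _),
    fun ε hε => ?_⟩)
  obtain ⟨i, hi⟩ := (hcover.eventually_lt_const hε).exists
  set s := spanningSets μ i
  have hs : MeasurableSet s := measurableSet_spanningSets μ i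
  have hsμ : μ s < ⊤ := measure_spanningSets_lt_top μ i
  have hone : Tendsto (fun n => ∫ x in s, f n x ∂μ) atTop (nhds (∫ x in s, F x ∂μ)) := by
    simpa using hset s hs hsμ (h := fun _ _ => 1) (H := fun _ => 1) (D := 1)
      (fun _ => aestronglyMeasurable_const) (by simp) fun _ => tendsto_const_nhds
  have hmain := tendsto_iff_norm_sub_tendsto_zero.1 (hset s hs hsμ hg hgC hgG)
  have hbound := (hmain.add ((hmass.sub hone).const_mul C)).add_const
    (C * (∫ x, F x ∂μ - ∫ x in s, F x ∂μ))
  filter_upwards [hbound.eventually_lt_const (u := ε) (by linarith)] with n hn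
  refine lt_of_le_of_lt ?_ hn
  have h₁ := tail hs (hf n) (fun x => (hf01 n x).1) (hg n) (hgC n)
  have h₂ := tail hs hF hF0 hGm hGC
  rw [Real.norm_eq_abs] at *
  rw [abs_le] at *
  have h₃ := le_abs_self (∫ x in s, f n x * g n x ∂μ - ∫ x in s, F x * G x ∂μ)
  have h₄ := neg_abs_le (∫ x in s, f n x * g n x ∂μ - ∫ x in s, F x * G x ∂μ)
  simp only [Real.norm_eq_abs]
  constructor <;> linarith [h₁.1, h₁.2, h₂.1, h₂.2]

end WeakStar

lemma integrable_indicator_ball_norm_rpow_s13 {E : Type*} [NormedAddCommGroup E] [NormedSpace ℝ E]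
    [FiniteDimensional ℝ E] [MeasurableSpace E] [BorelSpace E] (μ : Measure E)
    [μ.IsAddHaarMeasure] (hd : 1 ≤ Module.finrank ℝ E) {p r : ℝ}
    (hp : -(Module.finrank ℝ E : ℝ) < p) :
    Integrable ((ball (0 : E) r).indicator fun z => ‖z‖ ^ p) μ := by
  refine (integrable_indicator_iff measurableSet_ball).2 ?_
  refine integrableOn_ball_of_norm_le_rpow (C := 1) (α := -p) hd (by linarith)
    (.of_forall fun x => ?_) (measurable_norm.pow_const p).aestronglyMeasurable
  rw [neg_neg, one_mul, Real.norm_of_nonneg (by positivity)]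

theorem func_energy_weak_star_continuity (N : ℕ) (hN : 2 ≤ N) (α : ℝ) (hα₁ : 1 < α)
    (hα₂ : α < N) (f : ℕ → EuclideanSpace ℝ (Fin N) → ℝ) (F : EuclideanSpace ℝ (Fin N) → ℝ)
    (hfint : ∀ n, Integrable (f n)) (hf01 : ∀ n x, f n x ∈ Set.Icc (0 : ℝ) 1)
    (hFint : Integrable F) (hF01 : ∀ x, F x ∈ Set.Icc (0 : ℝ) 1)
    (hweak : ∀ φ : EuclideanSpace ℝ (Fin N) → ℝ, Integrable φ →
      Tendsto (fun n => ∫ x, f n x * φ x) atTop (nhds (∫ x, F x * φ x)))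
    (hmass : Tendsto (fun n => ∫ x, f n x) atTop (nhds (∫ x, F x))) :
    Tendsto (fun n => funcEnergy N α (f n)) atTop (nhds (funcEnergy N α F)) := by
  set k : EuclideanSpace ℝ (Fin N) → ℝ := fun z => ‖z‖ ^ (α - (N : ℝ)) with hk
  set near := (ball (0 : EuclideanSpace ℝ (Fin N)) 1).indicator k
  set far := (ball (0 : EuclideanSpace ℝ (Fin N)) 1)ᶜ.indicator k
  have hkm : Measurable k := measurable_norm.pow_const _
  have hsplit z : k z = near z + far z :=
    (congrFun (Set.indicator_self_add_compl _ k) z).symm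
  have hnear : Integrable near :=
    integrable_indicator_ball_norm_rpow_s13 volume (by simp; lia) (by simp; linarith)
  have hnear_nonneg z : 0 ≤ near z := Set.indicator_nonneg (fun _ _ => by positivity) z
  have hfarm : Measurable far := hkm.indicator measurableSet_ball.compl
  have hfar z : ‖far z‖ ≤ 1 := by
    by_cases hz : z ∈ ball (0 : EuclideanSpace ℝ (Fin N)) 1
    · simp [far, hz]
    · have h1 : 1 ≤ ‖z‖ := by simpa using hz
      simp only [far, Set.indicator_of_mem (Set.mem_compl hz), hk]
      rw [Real.norm_of_nonneg (by positivity)]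
      exact Real.rpow_le_one_of_one_le_of_nonpos h1 (by linarith)
  have hnear_x x : Integrable fun y => near (y - x) := hnear.comp_sub_right x
  have hfar_x x : AEStronglyMeasurable fun y => far (y - x) :=
    (hfarm.comp (measurable_id.sub_const x)).aestronglyMeasurable
  have hinear {u : EuclideanSpace ℝ (Fin N) → ℝ} (hu : Integrable u)
      (hu01 : ∀ x, u x ∈ Set.Icc (0 : ℝ) 1) x : Integrable fun y => u y * near (y - x) :=
    (hnear_x x).bdd_mul (c := 1) hu.1 (.of_forall fun y => by
      rw [Real.norm_of_nonneg (hu01 y).1]; exact (hu01 y).2)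
  have hifar {u : EuclideanSpace ℝ (Fin N) → ℝ} (hu : Integrable u) x :
      Integrable fun y => u y * far (y - x) :=
    hu.mul_bdd (hfar_x x) (.of_forall fun y => hfar _)
  have hpot {u : EuclideanSpace ℝ (Fin N) → ℝ} (hu : Integrable u)
      (hu01 : ∀ x, u x ∈ Set.Icc (0 : ℝ) 1) x :
      ∫ y, u y * k (y - x) = (∫ y, u y * near (y - x)) + ∫ y, u y * far (y - x) := by
    rw [← integral_add (hinear hu hu01 x) (hifar hu x)]
    simp_rw [hsplit, mul_add]
  have henergy (u : EuclideanSpace ℝ (Fin N) → ℝ) :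
      funcEnergy N α u = ∫ x, u x * ∫ y, u y * k (y - x) := by
    simp_rw [funcEnergy, hk, mul_assoc, integral_const_mul]
  obtain ⟨M, hM⟩ := hmass.bddAbove_range
  simp_rw [henergy]
  refine tendsto_integral_mul_of_bounded (C := (∫ y, near y) + M) hfint hf01 hFint
    (fun x => (hF01 x).1) hweak hmass (fun n => ?_) (fun n x => ?_) fun x => ?_
  · exact ((hfint n).1.comp_snd.mul
      (hkm.comp (measurable_snd.sub measurable_fst)).aestronglyMeasurable).integral_prod_right'
  · rw [hpot (hfint n) (hf01 n)]
    refine (norm_add_le _ _).trans (add_le_add ?_ ?_)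
    · rw [← integral_sub_right_eq_self near x]
      refine norm_integral_le_of_norm_le (hnear_x x) (.of_forall fun y => ?_)
      rw [Real.norm_of_nonneg (mul_nonneg (hf01 n y).1 (hnear_nonneg _))]
      exact mul_le_of_le_one_left (hnear_nonneg _) (hf01 n y).2
    · refine (norm_integral_le_of_norm_le (hfint n) (.of_forall fun y => ?_)).trans
        (hM ⟨n, rfl⟩)
      rw [norm_mul, Real.norm_of_nonneg (hf01 n y).1]
      exact mul_le_of_le_one_right (hf01 n y).1 (hfar _)
  · simp_rw [hpot (hfint _) (hf01 _), hpot hFint hF01]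
    exact (hweak _ (hnear_x x)).add (tendsto_integral_mul_of_bounded hfint hf01 hFint
      (fun x => (hF01 x).1) hweak hmass (fun _ => hfar_x x) (fun _ y => hfar _)
      fun _ => tendsto_const_nhds)
end
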